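/- arXiv:2502.19499 — 6 statements merged into one kernel-verified Lean document; each statement's English description precedes it below -/
import Mathlib

section
/- Let κ > 0 and set δ_t = κ√t. There exist constants t₁ > 0 and C > 0 (depending only on κ, n, and D) such that for all t ∈ (0, t₁) one has δ_t ∈ (0, Δ) and ((n − 1)/n)·F(κ) − C√t ≤ L_t[ŝ_{t,δ_t}] ≤ ((n − 1)/n)·F(κ) + C√t. -/
open MeasureTheory Real Set Filter
open scoped ENNReal

/-- Centered Gaussian density with standard deviation `σ`. -/
noncomputable def gaussD (x σ : ℝ) : ℝ :=
  (Real.sqrt (2 * Real.pi) * σ)⁻¹ * Real.exp (-x ^ 2 / (2 * σ ^ 2))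

/-- Training points `y_k = 2(k-1)Δ - D`, `Δ = D/(n-1)`. -/
noncomputable def trainPt (n : ℕ) (D : ℝ) (k : ℕ) : ℝ :=
  2 * ((k : ℝ) - 1) * (D / ((n : ℝ) - 1)) - D

/-- Noised empirical density `p_t`. -/
noncomputable def pEmp (n : ℕ) (D t x : ℝ) : ℝ :=
  (1 / (n : ℝ)) * ∑ k ∈ Finset.Icc 1 n, gaussD (x - trainPt n D k) (Real.sqrt t)

/-- Empirical score function `(d/dx) log p_t`. -/
noncomputable def scoreEmp (n : ℕ) (D t x : ℝ) : ℝ :=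
  deriv (fun y => Real.log (pEmp n D t y)) x

/-- Score matching loss `L_t[f]`. -/
noncomputable def scoreLoss (n : ℕ) (D t : ℝ) (f : ℝ → ℝ) : ℝ :=
  t * ∫ x, |f x - scoreEmp n D t x| ^ 2 * pEmp n D t x

/-- `F(κ) = 2 ∫_κ^∞ (u-κ)² p_N(u;1) du`. -/
noncomputable def Fgauss (κ : ℝ) : ℝ :=
  2 * ∫ u in Set.Ioi κ, (u - κ) ^ 2 * gaussD u 1

/-- The smoothed piecewise-linear empirical score function `ŝ_{t,δ}` (as a predicate
characterizing it by its defining piecewise formulas). -/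
def IsShat (n : ℕ) (D t δ : ℝ) (s : ℝ → ℝ) : Prop :=
  (∀ x ≤ trainPt n D 1 + δ, s x = (trainPt n D 1 - x) / t) ∧
  (∀ x, trainPt n D n - δ ≤ x → s x = (trainPt n D n - x) / t) ∧
  (∀ k, 2 ≤ k → k ≤ n - 1 →
    ∀ x ∈ Set.Icc (trainPt n D k - δ) (trainPt n D k + δ),
      s x = (trainPt n D k - x) / t) ∧
  (∀ k, 1 ≤ k → k ≤ n - 1 →
    ∀ x ∈ Set.Icc (trainPt n D k + δ) (trainPt n D (k + 1) - δ),
      s x = (δ / (D / ((n : ℝ) - 1) - δ)) * (x - (trainPt n D k + D / ((n : ℝ) - 1))) / t)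

/-- Non-smoothness measure `R[f]`: the total variation over ℝ of the derivative `f'`
(taken over the set where `f` is differentiable). -/
noncomputable def Rns (f : ℝ → ℝ) : ℝ≥0∞ :=
  eVariationOn (deriv f) {x | DifferentiableAt ℝ f x}

lemma trainPt_succ (n : ℕ) (D : ℝ) (k : ℕ) :
    trainPt n D (k + 1) = trainPt n D k + 2 * (D / ((n : ℝ) - 1)) := by
  simp only [trainPt]; push_cast; ring

lemma spacing_pos {n : ℕ} (hn : 2 ≤ n) {D : ℝ} (hD : 0 < D) : 0 < D / ((n : ℝ) - 1) := by
  have : (2 : ℝ) ≤ n := by exact_mod_cast hn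
  exact div_pos hD (by linarith)

lemma abs_trainPt_le {n : ℕ} (hn : 2 ≤ n) {D : ℝ} (hD : 0 < D) {k : ℕ} (h1 : 1 ≤ k)
    (h2 : k ≤ n) : |trainPt n D k| ≤ D := by
  have hE := spacing_pos hn hD
  have h2n : (2 : ℝ) ≤ n := by exact_mod_cast hn
  have hmul : ((n : ℝ) - 1) * (D / ((n : ℝ) - 1)) = D := by
    field_simp [show (n : ℝ) - 1 ≠ 0 by linarith]
  have h1' : (1 : ℝ) ≤ k := by exact_mod_cast h1
  have h2' : (k : ℝ) ≤ n := by exact_mod_cast h2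
  rw [abs_le, trainPt]
  constructor <;> nlinarith

lemma exists_piece {n : ℕ} (D δ x : ℝ) (hx : trainPt n D 1 + δ < x) (m : ℕ) (hm : 1 ≤ m)
    (hxm : x < trainPt n D m - δ) (hδ : 0 ≤ δ) :
    (∃ k, 2 ≤ k ∧ k ≤ m - 1 ∧ x ∈ Set.Icc (trainPt n D k - δ) (trainPt n D k + δ)) ∨
    (∃ k, 1 ≤ k ∧ k ≤ m - 1 ∧ x ∈ Set.Icc (trainPt n D k + δ) (trainPt n D (k + 1) - δ)) := by
  induction m, hm using Nat.le_induction with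
  | base => linarith
  | succ m hm ih =>
    rcases lt_or_ge x (trainPt n D m - δ) with h | h
    · rcases ih h with ⟨k, h1, h2, h3⟩ | ⟨k, h1, h2, h3⟩
      · exact Or.inl ⟨k, h1, by omega, h3⟩
      · exact Or.inr ⟨k, h1, by omega, h3⟩
    · rcases le_or_gt x (trainPt n D m + δ) with h' | h'
      · have : m ≠ 1 := by rintro rfl; linarith
        exact Or.inl ⟨m, by omega, by omega, h, h'⟩
      · exact Or.inr ⟨m, hm, by omega, h'.le, hxm.le⟩

lemma cover_pieces {n : ℕ} (hn : 2 ≤ n) (D δ x : ℝ) (hδ : 0 ≤ δ) :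
    x ≤ trainPt n D 1 + δ ∨ trainPt n D n - δ ≤ x ∨
    (∃ k, 2 ≤ k ∧ k ≤ n - 1 ∧ x ∈ Set.Icc (trainPt n D k - δ) (trainPt n D k + δ)) ∨
    (∃ k, 1 ≤ k ∧ k ≤ n - 1 ∧ x ∈ Set.Icc (trainPt n D k + δ) (trainPt n D (k + 1) - δ)) := by
  by_contra! h
  rcases exists_piece D δ x h.1 n (by omega) h.2.1 hδ with ⟨k, h1, h2, h3⟩ | ⟨k, h1, h2, h3⟩
  · exact h.2.2.1 k h1 h2 h3
  · exact h.2.2.2 k h1 h2 h3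

lemma IsShat.continuous {n : ℕ} (hn : 2 ≤ n) {D t δ : ℝ} (hδ : 0 ≤ δ) {s : ℝ → ℝ}
    (hs : IsShat n D t δ s) : Continuous s := by
  obtain ⟨hl, hr, hm, hi⟩ := hs
  let P : Fin n × Bool ⊕ Bool → Set ℝ := fun i => match i with
    | .inl (k, true) => if 2 ≤ (k : ℕ) then
        Set.Icc (trainPt n D k - δ) (trainPt n D k + δ) else ∅
    | .inl (k, false) => if 1 ≤ (k : ℕ) then
        Set.Icc (trainPt n D k + δ) (trainPt n D (k + 1) - δ) else ∅
    | .inr true => Set.Iic (trainPt n D 1 + δ)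
    | .inr false => Set.Ici (trainPt n D n - δ)
  refine (locallyFinite_of_finite P).continuous ?_ ?_ ?_
  · refine Set.eq_univ_of_forall fun x => Set.mem_iUnion.2 ?_
    rcases cover_pieces hn D δ x hδ with h | h | ⟨k, h1, h2, h⟩ | ⟨k, h1, h2, h⟩
    · exact ⟨.inr true, h⟩
    · exact ⟨.inr false, h⟩
    · exact ⟨.inl (⟨k, by omega⟩, true), by simpa [P, h1] using h⟩
    · exact ⟨.inl (⟨k, by omega⟩, false), by
        simp only [P, h1, if_true]; exact h⟩
  · rintro (⟨k, _ | _⟩ | _ | _) <;> dsimp only [P]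
    · split_ifs; exacts [isClosed_Icc, isClosed_empty]
    · split_ifs; exacts [isClosed_Icc, isClosed_empty]
    · exact isClosed_Ici
    · exact isClosed_Iic
  · rintro (⟨k, _ | _⟩ | _ | _) <;> dsimp only [P]
    · split_ifs with h
      · exact ContinuousOn.congr (by fun_prop) (hi k h (by omega))
      · exact continuousOn_empty _
    · split_ifs with h
      · exact ContinuousOn.congr (by fun_prop) (hm k h (by omega))
      · exact continuousOn_empty _
    · exact ContinuousOn.congr (f := fun x => (trainPt n D n - x) / t) (by fun_prop)
        fun x hx => hr x hx
    · exact ContinuousOn.congr (f := fun x => (trainPt n D 1 - x) / t) (by fun_prop)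
        fun x hx => hl x hx

lemma IsShat.abs_apply_le {n : ℕ} (hn : 2 ≤ n) {D t δ : ℝ} (hD : 0 < D) (ht : 0 < t) (hδ : 0 ≤ δ)
    (hδE : δ ≤ D / ((n : ℝ) - 1) / 2) {s : ℝ → ℝ} (hs : IsShat n D t δ s) (x : ℝ) :
    |s x| ≤ (|x| + D) / t := by
  have hE := spacing_pos hn hD
  have key : ∀ y, |y| ≤ D → |(y - x) / t| ≤ (|x| + D) / t := fun y hy => by
    rw [abs_div, abs_of_pos ht]
    gcongr
    linarith [abs_sub y x]
  obtain ⟨hl, hr, hm, hi⟩ := hs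
  rcases cover_pieces hn D δ x hδ with h | h | ⟨k, h1, h2, h⟩ | ⟨k, h1, h2, h⟩
  · rw [hl x h]; exact key _ (abs_trainPt_le hn hD le_rfl (by omega))
  · rw [hr x h]; exact key _ (abs_trainPt_le hn hD (by omega) le_rfl)
  · rw [hm k h1 h2 x h]; exact key _ (abs_trainPt_le hn hD (by omega) (by omega))
  · rw [hi k h1 h2 x h]
    set E := D / ((n : ℝ) - 1)
    have hz : |trainPt n D k + E| ≤ D := by
      have a := abs_le.1 (abs_trainPt_le hn hD h1 (show k ≤ n by omega))
      have b := abs_le.1 (abs_trainPt_le hn hD (show 1 ≤ k + 1 by omega) (show k + 1 ≤ n by omega))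
      rw [trainPt_succ] at b
      exact abs_le.2 ⟨by linarith, by linarith⟩
    rw [mul_div_assoc, abs_mul, abs_of_nonneg (div_nonneg hδ (by linarith : (0 : ℝ) ≤ E - δ))]
    have h3 := key _ hz
    rw [← abs_neg, ← neg_div, neg_sub] at h3
    have h4 : δ / (E - δ) ≤ 1 := (div_le_one (by linarith)).2 (by linarith)
    calc _ ≤ 1 * ((|x| + D) / t) := by gcongr
      _ = _ := one_mul _

lemma abs_sq_sub_sq_le_of_slope {E D κ r u h : ℝ} (hE : 0 < E) (hD : 0 < D) (hκ : 0 < κ)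
    (hr : 0 < r) (hκr : κ * r ≤ E / 2) (hu : κ < u)
    (hlin : u * r ≤ 2 * E - κ * r → h = (u - κ) * (E / (E - κ * r)))
    (hgrow : |h| ≤ 2 * |u| + 2 * D / r) :
    |h ^ 2 - (u - κ) ^ 2| ≤ (6 * κ / E + (2 + 2 * D / E) ^ 2 / E) * r * (u ^ 2 + u ^ 4) := by
  have hu0 : 0 < u := hκ.trans hu
  rcases le_or_gt (u * r) (2 * E - κ * r) with hle | hgt
  · rw [hlin hle]
    have hpos : 0 < E - κ * r := by linarith
    set c := E / (E - κ * r) with hc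
    have hcE : c * (E - κ * r) = E := by rw [hc]; field_simp
    have hc1 : 1 ≤ c := by rw [hc, one_le_div hpos]; nlinarith
    have hc2 : c ≤ 2 := by rw [hc, div_le_iff₀ hpos]; linarith
    have hc3 : c - 1 ≤ 2 * κ * r / E := by
      rw [le_div_iff₀ hE]; nlinarith [mul_pos hκ hr]
    have hc4 : c ^ 2 - 1 ≤ 6 * κ / E * r := by
      have : 6 * κ / E * r = 3 * (2 * κ * r / E) := by ring
      rw [this]; nlinarith
    have e : ((u - κ) * c) ^ 2 - (u - κ) ^ 2 = (c ^ 2 - 1) * (u - κ) ^ 2 := by ring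
    rw [e, abs_of_nonneg (mul_nonneg (by nlinarith) (sq_nonneg _))]
    have h5 : (u - κ) ^ 2 ≤ u ^ 2 + u ^ 4 := by nlinarith [sq_nonneg (u ^ 2)]
    have h6 : 0 ≤ (2 + 2 * D / E) ^ 2 / E * r := by positivity
    calc _ ≤ (6 * κ / E * r) * (u ^ 2 + u ^ 4) := by gcongr
      _ ≤ _ := by
        have : 0 ≤ (2 + 2 * D / E) ^ 2 / E * r * (u ^ 2 + u ^ 4) := by positivity
        linarith
  · have h1 : E ≤ u * r := by linarith
    have h2 : |h| ≤ (2 + 2 * D / E) * u := by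
      rw [abs_of_pos hu0] at hgrow
      have : 2 * D / r ≤ 2 * D / E * u := by
        rw [div_le_iff₀ hr]
        calc 2 * D = 2 * D / E * E := by field_simp
          _ ≤ 2 * D / E * (u * r) := by gcongr
          _ = _ := by ring
      linarith
    have h3 : h ^ 2 ≤ (2 + 2 * D / E) ^ 2 * u ^ 2 := by
      rw [← sq_abs h, ← mul_pow]; gcongr
    have h4 : (u - κ) ^ 2 ≤ (2 + 2 * D / E) ^ 2 * u ^ 2 := by
      have : (1 : ℝ) ≤ 2 + 2 * D / E := by
        have : 0 ≤ 2 * D / E := by positivity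
        linarith
      rw [← mul_pow]
      apply pow_le_pow_left₀ (by linarith)
      nlinarith
    have h5 : |h ^ 2 - (u - κ) ^ 2| ≤ (2 + 2 * D / E) ^ 2 * u ^ 2 :=
      abs_sub_le_of_nonneg_of_le (sq_nonneg _) h3 (sq_nonneg _) h4
    have h6 : u ^ 2 ≤ r / E * (u ^ 2 + u ^ 4) := by
      have h7 : u ^ 3 ≤ u ^ 2 + u ^ 4 := by nlinarith [sq_nonneg (u * (u - 1)), sq_nonneg u, sq_nonneg (u^2)]
      calc u ^ 2 = u ^ 2 * E / E := by field_simp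
        _ ≤ u ^ 2 * (u * r) / E := by gcongr
        _ = r / E * u ^ 3 := by ring
        _ ≤ _ := by gcongr
    calc _ ≤ _ := h5
      _ ≤ (2 + 2 * D / E) ^ 2 * (r / E * (u ^ 2 + u ^ 4)) := by gcongr
      _ = (2 + 2 * D / E) ^ 2 / E * r * (u ^ 2 + u ^ 4) := by ring
      _ ≤ _ := by
        have : 0 ≤ 6 * κ / E * r * (u ^ 2 + u ^ 4) := by positivity
        linarith

lemma rescaled_slope {E κ r u : ℝ} (hr : r ≠ 0) (h : E - κ * r ≠ 0) :
    r * (κ * r / (E - κ * r) * (r * u - E) / r ^ 2) + u = (u - κ) * (E / (E - κ * r)) := by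
  obtain ⟨W, hW⟩ : ∃ W, W = E - κ * r := ⟨_, rfl⟩
  obtain rfl : E = W + κ * r := by rw [hW]; ring
  rw [← hW] at h ⊢
  field_simp
  ring

/-- The limiting rescaled squared error seen from the `k`-th of `n` training points. -/
noncomputable def limitSqErr (n : ℕ) (κ : ℝ) (k : ℕ) (u : ℝ) : ℝ :=
  (if k < n then max (u - κ) 0 ^ 2 else 0) + (if 1 < k then max (-u - κ) 0 ^ 2 else 0)

lemma IsShat.abs_sq_sub_limitSqErr_le {n : ℕ} (hn : 2 ≤ n) {D κ r : ℝ} (hD : 0 < D) (hκ : 0 < κ)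
    (hr : 0 < r) (hκr : κ * r ≤ D / ((n : ℝ) - 1) / 2) {s : ℝ → ℝ}
    (hs : IsShat n D (r ^ 2) (κ * r) s) {k : ℕ} (h1 : 1 ≤ k) (h2 : k ≤ n) (u : ℝ) :
    |(r * s (r * u + trainPt n D k) + u) ^ 2 - limitSqErr n κ k u| ≤
      (6 * κ / (D / ((n : ℝ) - 1)) + (2 + 2 * D / (D / ((n : ℝ) - 1))) ^ 2 / (D / ((n : ℝ) - 1)))
        * r * (u ^ 2 + u ^ 4) := by
  have hE := spacing_pos hn hD
  have hgrow : |r * s (r * u + trainPt n D k) + u| ≤ 2 * |u| + 2 * D / r := by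
    have a := hs.abs_apply_le hn hD (by positivity) (by positivity) hκr (r * u + trainPt n D k)
    have b : |r * u + trainPt n D k| ≤ r * |u| + D := by
      calc _ ≤ |r * u| + |trainPt n D k| := abs_add_le _ _
        _ ≤ _ := by rw [abs_mul, abs_of_pos hr]; gcongr; exact abs_trainPt_le hn hD h1 h2
    calc _ ≤ |r * s (r * u + trainPt n D k)| + |u| := abs_add_le _ _
      _ ≤ r * ((r * |u| + D + D) / r ^ 2) + |u| := by
        rw [abs_mul, abs_of_pos hr]; gcongr; exact a.trans (by gcongr)
      _ = _ := by field_simp; ring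
  obtain ⟨hl, hrt, hm, hi⟩ := hs
  have hzero : ∀ v, s (r * v + trainPt n D k) =
      (trainPt n D k - (r * v + trainPt n D k)) / r ^ 2 → r * s (r * v + trainPt n D k) + v = 0 := by
    intro v hv; rw [hv]; field_simp; ring
  set E := D / ((n : ℝ) - 1)
  have hK : 0 ≤ (6 * κ / E + (2 + 2 * D / E) ^ 2 / E) * r * (u ^ 2 + u ^ 4) := by positivity
  have hpos : E - κ * r ≠ 0 := ne_of_gt (by linarith)
  rcases lt_or_ge κ u with hu | hu
  · have hq2 : max (-u - κ) 0 = 0 := max_eq_right (by linarith)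
    have hq1 : max (u - κ) 0 = u - κ := max_eq_left (by linarith)
    simp only [limitSqErr, hq1, hq2]
    split_ifs with hkn hk1 hk1
    · simp only [ne_eq, OfNat.ofNat_ne_zero, not_false_eq_true, zero_pow, add_zero]
      refine abs_sq_sub_sq_le_of_slope hE hD hκ hr hκr hu (fun hle => ?_) hgrow
      rw [hi k h1 (by omega) _ ⟨by nlinarith, by rw [trainPt_succ]; linarith⟩, ← rescaled_slope hr.ne' hpos]
      ring
    · simp only [add_zero]
      refine abs_sq_sub_sq_le_of_slope hE hD hκ hr hκr hu (fun hle => ?_) hgrow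
      rw [hi k h1 (by omega) _ ⟨by nlinarith, by rw [trainPt_succ]; linarith⟩, ← rescaled_slope hr.ne' hpos]
      ring
    all_goals
      obtain rfl : k = n := by omega
      rw [hzero u (hrt _ (by nlinarith))]
      simpa using hK
  rcases lt_or_ge u (-κ) with hu' | hu'
  · have hq2 : max (-u - κ) 0 = -u - κ := max_eq_left (by linarith)
    have hq1 : max (u - κ) 0 = 0 := max_eq_right (by linarith)
    have e : limitSqErr n κ k u = if 1 < k then (-u - κ) ^ 2 else 0 := by
      simp [limitSqErr, hq1, hq2]
    rw [e]
    split_ifs with hk1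
    · have := abs_sq_sub_sq_le_of_slope (u := -u) (h := -(r * s (r * u + trainPt n D k) + u))
        hE hD hκ hr hκr (by linarith) (fun hle => ?_) (by rwa [abs_neg, abs_neg])
      · simpa only [neg_sq, even_two, Even.neg_pow, show (-u) ^ 4 = u ^ 4 by ring] using this
      · obtain ⟨j, rfl⟩ : ∃ j, k = j + 1 := ⟨k - 1, by omega⟩
        have hts := trainPt_succ n D j
        rw [hi j (by omega) (by omega) _ ⟨by rw [hts]; linarith, by nlinarith⟩, hts,
          ← rescaled_slope hr.ne' hpos]
        ring
    · obtain rfl : k = 1 := by omega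
      rw [hzero u (hl _ (by nlinarith))]
      simpa using hK
  · have hq2 : max (-u - κ) 0 = 0 := max_eq_right (by linarith)
    have hq1 : max (u - κ) 0 = 0 := max_eq_right (by linarith)
    have e : limitSqErr n κ k u = 0 := by simp [limitSqErr, hq1, hq2]
    have hz : r * s (r * u + trainPt n D k) + u = 0 := by
      refine hzero u ?_
      by_cases hk1 : k = 1
      · subst hk1; exact hl _ (by nlinarith)
      by_cases hkn : k = n
      · subst hkn; exact hrt _ (by nlinarith)
      exact hm k (by omega) (by omega) _ ⟨by nlinarith, by nlinarith⟩
    rw [e, hz]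
    simpa using hK

lemma gaussD_pos (x : ℝ) {r : ℝ} (hr : 0 < r) : 0 < gaussD x r := by
  unfold gaussD; positivity

lemma gaussD_mul_self {r : ℝ} (hr : 0 < r) (u : ℝ) : gaussD (r * u) r = r⁻¹ * gaussD u 1 := by
  have : -(r * u) ^ 2 / (2 * r ^ 2) = -u ^ 2 / (2 * 1 ^ 2) := by field_simp
  rw [gaussD, gaussD, this, mul_inv, mul_inv]; ring

lemma gaussD_neg (x r : ℝ) : gaussD (-x) r = gaussD x r := by simp [gaussD]

@[fun_prop]
lemma continuous_gaussD (r : ℝ) : Continuous fun x => gaussD x r := by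
  unfold gaussD; fun_prop

lemma integrable_pow_mul_gaussD_one (m : ℕ) : Integrable fun u : ℝ => u ^ m * gaussD u 1 := by
  have h := (integrable_rpow_mul_exp_neg_mul_sq (b := 1 / 2) (by norm_num) (s := m)
    (by linarith [Nat.cast_nonneg (α := ℝ) m])).const_mul ((√(2 * π) * 1)⁻¹)
  refine h.congr (ae_of_all _ fun u => ?_)
  simp only [gaussD, rpow_natCast]
  rw [show -u ^ 2 / (2 * 1 ^ 2) = -(1 / 2) * u ^ 2 by ring]; ring

lemma integral_gaussD_one : ∫ u, gaussD u 1 = 1 := by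
  have h : ∀ u, gaussD u 1 = (√(2 * π))⁻¹ * rexp (-(1 / 2) * u ^ 2) := fun u => by
    rw [gaussD, show -u ^ 2 / (2 * 1 ^ 2) = -(1 / 2) * u ^ 2 by ring, mul_one]
  simp_rw [h]
  rw [integral_const_mul, integral_gaussian, show π / (1 / 2) = 2 * π by ring]
  exact inv_mul_cancel₀ (by positivity)

lemma mul_gaussD_comp_affine (f : ℝ → ℝ) (y : ℝ) {r : ℝ} (hr : 0 < r) (u : ℝ) :
    f (r * u + y) * gaussD (r * u + y - y) r = r⁻¹ * (f (r * u + y) * gaussD u 1) := by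
  rw [add_sub_cancel_right, gaussD_mul_self hr]; ring

lemma integral_mul_gaussD (f : ℝ → ℝ) (y : ℝ) {r : ℝ} (hr : 0 < r) :
    ∫ x, f x * gaussD (x - y) r = ∫ u, f (r * u + y) * gaussD u 1 := by
  have h1 := integral_add_right_eq_self (μ := volume) (fun x => f x * gaussD (x - y) r) y
  have h2 := Measure.integral_comp_mul_left (fun x => f (x + y) * gaussD (x + y - y) r) r
  simp only [mul_gaussD_comp_affine f y hr, integral_const_mul, h1, smul_eq_mul] at h2
  rw [abs_of_pos (inv_pos.2 hr)] at h2
  exact (mul_left_cancel₀ (inv_ne_zero hr.ne') h2).symm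

lemma integrable_mul_gaussD_iff (f : ℝ → ℝ) (y : ℝ) {r : ℝ} (hr : 0 < r) :
    Integrable (fun x => f x * gaussD (x - y) r) ↔
      Integrable fun u => f (r * u + y) * gaussD u 1 := by
  have h2 := integrable_comp_mul_left_iff (fun x => f (x + y) * gaussD (x + y - y) r) hr.ne'
  simp only [mul_gaussD_comp_affine f y hr] at h2
  rw [integrable_const_mul_iff (isUnit_iff_ne_zero.2 (inv_ne_zero hr.ne'))] at h2
  rw [h2]
  refine ⟨fun h => h.comp_add_right y, fun h => ?_⟩
  simpa only [sub_add_cancel] using h.comp_sub_right y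

lemma integrable_gaussD (y : ℝ) {r : ℝ} (hr : 0 < r) :
    Integrable fun x => gaussD (x - y) r := by
  have := (integrable_mul_gaussD_iff (fun _ => 1) y hr).2
    (by simpa using integrable_pow_mul_gaussD_one 0)
  simpa using this

lemma integral_gaussD (y : ℝ) {r : ℝ} (hr : 0 < r) : ∫ x, gaussD (x - y) r = 1 := by
  simpa [integral_gaussD_one] using integral_mul_gaussD (fun _ => 1) y hr

lemma gaussD_mul_gaussD_le {r : ℝ} (hr : 0 < r) {a b G : ℝ} (hab : a ≠ b) (x : ℝ)
    (hG : gaussD (x - a) r + gaussD (x - b) r ≤ G) :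
    ((a - x) / r ^ 2 - (b - x) / r ^ 2) ^ 2 * (gaussD (x - a) r * gaussD (x - b) r) / G ≤
      128 / (a - b) ^ 2 * gaussD (x - (a + b) / 2) r := by
  have hd : 0 < (a - b) ^ 2 := by have := sub_ne_zero.2 hab; positivity
  have ha := gaussD_pos (x - a) hr
  have hb := gaussD_pos (x - b) hr
  have hm := gaussD_pos (x - (a + b) / 2) hr
  set w := rexp (-(a - b) ^ 2 / (8 * r ^ 2)) with hw
  have hw0 : 0 < w := exp_pos _
  have hprod : gaussD (x - a) r * gaussD (x - b) r = (gaussD (x - (a + b) / 2) r * w) ^ 2 := by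
    have hexp : -(x - a) ^ 2 / (2 * r ^ 2) + -(x - b) ^ 2 / (2 * r ^ 2) =
        2 * (-(x - (a + b) / 2) ^ 2 / (2 * r ^ 2) + -(a - b) ^ 2 / (8 * r ^ 2)) := by
      field_simp; ring
    have hmul : rexp (-(x - a) ^ 2 / (2 * r ^ 2)) * rexp (-(x - b) ^ 2 / (2 * r ^ 2)) =
        (rexp (-(x - (a + b) / 2) ^ 2 / (2 * r ^ 2)) * w) ^ 2 := by
      rw [hw, ← Real.exp_add, ← Real.exp_add, hexp, two_mul, Real.exp_add, sq (rexp _)]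
    rw [gaussD, gaussD, gaussD, mul_mul_mul_comm, hmul]
    ring
  have hle : gaussD (x - (a + b) / 2) r * w ≤ G := by
    refine le_trans ?_ hG
    refine (le_abs_self _).trans (abs_le_of_sq_le_sq ?_ (by positivity))
    rw [← hprod]; nlinarith
  have hG0 : 0 < G := by linarith
  have hexp : w ≤ 128 * r ^ 4 / ((a - b) ^ 2) ^ 2 := by
    have hz : 0 ≤ (a - b) ^ 2 / (8 * r ^ 2) := by positivity
    have hq := quadratic_le_exp_of_nonneg hz
    rw [hw, neg_div, Real.exp_neg, inv_le_comm₀ (exp_pos _) (by positivity)]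
    have : (128 * r ^ 4 / ((a - b) ^ 2) ^ 2)⁻¹ = ((a - b) ^ 2 / (8 * r ^ 2)) ^ 2 / 2 := by
      field_simp; norm_num
    rw [this]; linarith
  have e : ((a - x) / r ^ 2 - (b - x) / r ^ 2) ^ 2 = (a - b) ^ 2 / r ^ 4 := by
    field_simp; ring
  rw [hprod, e, div_le_iff₀ hG0, sq (_ * w)]
  have h1 : (a - b) ^ 2 / r ^ 4 * (gaussD (x - (a + b) / 2) r * w) ≤
      128 / (a - b) ^ 2 * gaussD (x - (a + b) / 2) r := by
    calc _ ≤ (a - b) ^ 2 / r ^ 4 * (gaussD (x - (a + b) / 2) r *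
          (128 * r ^ 4 / ((a - b) ^ 2) ^ 2)) := by gcongr
      _ = _ := by field_simp
  rw [← mul_assoc]
  exact mul_le_mul h1 hle (by positivity) (by positivity)

lemma sum_sq_sub_weighted {ι : Type*} (I : Finset ι) (a g : ι → ℝ) (s : ℝ)
    (hG : ∑ k ∈ I, g k ≠ 0) :
    ∑ k ∈ I, (s - a k) ^ 2 * g k =
      (s - (∑ k ∈ I, a k * g k) / ∑ k ∈ I, g k) ^ 2 * ∑ k ∈ I, g k +
      (∑ k ∈ I, ∑ j ∈ I, (a k - a j) ^ 2 * (g k * g j) / ∑ k ∈ I, g k) / 2 := by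
  set G := ∑ k ∈ I, g k with hGd
  set A := ∑ k ∈ I, a k * g k with hA
  set B := ∑ k ∈ I, a k ^ 2 * g k with hB
  have h1 : ∑ k ∈ I, (s - a k) ^ 2 * g k = s ^ 2 * G - 2 * s * A + B := by
    rw [hGd, hA, hB, Finset.mul_sum, Finset.mul_sum, ← Finset.sum_sub_distrib,
      ← Finset.sum_add_distrib]
    exact Finset.sum_congr rfl fun k _ => by ring
  have h2 : ∑ k ∈ I, ∑ j ∈ I, (a k - a j) ^ 2 * (g k * g j) / G = (2 * B * G - 2 * A ^ 2) / G := by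
    simp_rw [← Finset.sum_div]
    congr 1
    have : ∀ k ∈ I, ∑ j ∈ I, (a k - a j) ^ 2 * (g k * g j) =
        a k ^ 2 * g k * G - 2 * (a k * g k) * A + g k * B := fun k _ => by
      rw [hGd, hA, hB, Finset.mul_sum, Finset.mul_sum, Finset.mul_sum, ← Finset.sum_sub_distrib,
        ← Finset.sum_add_distrib]
      exact Finset.sum_congr rfl fun j _ => by ring
    rw [Finset.sum_congr rfl this, Finset.sum_add_distrib, Finset.sum_sub_distrib,
      ← Finset.sum_mul, ← Finset.sum_mul, ← Finset.sum_mul, ← Finset.mul_sum]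
    ring
  rw [h1, h2]
  field_simp
  ring

lemma pEmp_sq (n : ℕ) (D : ℝ) {r : ℝ} (hr : 0 < r) (x : ℝ) :
    pEmp n D (r ^ 2) x = 1 / (n : ℝ) * ∑ k ∈ Finset.Icc 1 n, gaussD (x - trainPt n D k) r := by
  rw [pEmp, Real.sqrt_sq hr.le]

lemma hasDerivAt_gaussD_sub (y : ℝ) {r : ℝ} (hr : 0 < r) (x : ℝ) :
    HasDerivAt (fun x => gaussD (x - y) r) ((y - x) / r ^ 2 * gaussD (x - y) r) x := by
  have h : HasDerivAt (fun x => -(x - y) ^ 2 / (2 * r ^ 2)) ((y - x) / r ^ 2) x := by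
    refine (((((hasDerivAt_id x).sub_const y).pow 2).neg).div_const (2 * r ^ 2)).congr_deriv ?_
    simp only [id]; field_simp; ring
  refine (h.exp.const_mul ((√(2 * π) * r)⁻¹)).congr_deriv ?_
  rw [gaussD]; ring

lemma sum_gaussD_pos {n : ℕ} (hn : 1 ≤ n) (D : ℝ) {r : ℝ} (hr : 0 < r) (x : ℝ) :
    0 < ∑ k ∈ Finset.Icc 1 n, gaussD (x - trainPt n D k) r :=
  Finset.sum_pos (fun _ _ => gaussD_pos _ hr) ⟨1, Finset.mem_Icc.2 ⟨le_rfl, hn⟩⟩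

lemma scoreEmp_sq {n : ℕ} (hn : 1 ≤ n) (D : ℝ) {r : ℝ} (hr : 0 < r) (x : ℝ) :
    scoreEmp n D (r ^ 2) x =
      (∑ k ∈ Finset.Icc 1 n, (trainPt n D k - x) / r ^ 2 * gaussD (x - trainPt n D k) r) /
        ∑ k ∈ Finset.Icc 1 n, gaussD (x - trainPt n D k) r := by
  have hn0 : (n : ℝ) ≠ 0 := by positivity
  have hG := sum_gaussD_pos hn D hr x
  have h := (HasDerivAt.fun_sum (u := Finset.Icc 1 n) fun k _ =>
    hasDerivAt_gaussD_sub (trainPt n D k) hr x).const_mul (1 / (n : ℝ))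
  have h' := (h.log (by positivity)).deriv
  unfold scoreEmp
  simp_rw [pEmp_sq n D hr]
  rw [h']
  field_simp

lemma two_mul_spacing_le (n : ℕ) (D : ℝ) {j k : ℕ} (h : j ≠ k) :
    (2 * (D / ((n : ℝ) - 1))) ^ 2 ≤ (trainPt n D j - trainPt n D k) ^ 2 := by
  have e : trainPt n D j - trainPt n D k = ((j : ℤ) - (k : ℤ) : ℤ) * (2 * (D / ((n : ℝ) - 1))) := by
    simp only [trainPt]; push_cast; ring
  rw [e, mul_pow]
  have h1 : (1 : ℤ) ≤ ((j : ℤ) - k) ^ 2 := by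
    have : (j : ℤ) - k ≠ 0 := by omega
    have := Int.one_le_abs this
    rw [← sq_abs]; nlinarith
  have h2 : (1 : ℝ) ≤ (((j : ℤ) - (k : ℤ) : ℤ) : ℝ) ^ 2 := by exact_mod_cast h1
  nlinarith [sq_nonneg (2 * (D / ((n : ℝ) - 1)))]

lemma sum_variance_le {n : ℕ} (hn : 2 ≤ n) {D : ℝ} (hD : 0 < D) {r : ℝ} (hr : 0 < r) (x : ℝ) :
    ∑ k ∈ Finset.Icc 1 n, ∑ j ∈ Finset.Icc 1 n,
      ((trainPt n D k - x) / r ^ 2 - (trainPt n D j - x) / r ^ 2) ^ 2 *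
        (gaussD (x - trainPt n D k) r * gaussD (x - trainPt n D j) r) /
        ∑ k ∈ Finset.Icc 1 n, gaussD (x - trainPt n D k) r ≤
      ∑ k ∈ Finset.Icc 1 n, ∑ j ∈ Finset.Icc 1 n,
        32 / (D / ((n : ℝ) - 1)) ^ 2 *
          gaussD (x - (trainPt n D k + trainPt n D j) / 2) r := by
  have hE := spacing_pos hn hD
  refine Finset.sum_le_sum fun k hk => Finset.sum_le_sum fun j hj => ?_
  have hm := gaussD_pos (x - (trainPt n D k + trainPt n D j) / 2) hr
  rcases eq_or_ne k j with rfl | hkj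
  · rw [sub_self, sq, zero_mul, zero_mul, zero_div]
    positivity
  · have hsp := two_mul_spacing_le n D hkj
    have hpair : gaussD (x - trainPt n D k) r + gaussD (x - trainPt n D j) r ≤
        ∑ k ∈ Finset.Icc 1 n, gaussD (x - trainPt n D k) r := by
      rw [← Finset.sum_pair (f := fun k => gaussD (x - trainPt n D k) r) hkj]
      refine Finset.sum_le_sum_of_subset_of_nonneg ?_ fun _ _ _ => (gaussD_pos _ hr).le
      exact Finset.insert_subset hk (Finset.singleton_subset_iff.2 hj)
    generalize D / ((n : ℝ) - 1) = E at hE hsp ⊢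
    have hne : trainPt n D k ≠ trainPt n D j := by
      intro h
      rw [h, sub_self] at hsp
      nlinarith
    refine (gaussD_mul_gaussD_le hr hne x hpair).trans ?_
    refine mul_le_mul_of_nonneg_right ?_ hm.le
    have : 32 / E ^ 2 = 128 / (2 * E) ^ 2 := by
      rw [mul_pow]; field_simp; norm_num
    rw [this]
    exact div_le_div_of_nonneg_left (by norm_num) (by positivity) hsp

lemma scoreLoss_integrand_bounds {n : ℕ} (hn : 2 ≤ n) {D : ℝ} (hD : 0 < D) {r : ℝ} (hr : 0 < r)
    (s x : ℝ) :
    |s - scoreEmp n D (r ^ 2) x| ^ 2 * pEmp n D (r ^ 2) x ≤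
      1 / (n : ℝ) * ∑ k ∈ Finset.Icc 1 n,
        (s - (trainPt n D k - x) / r ^ 2) ^ 2 * gaussD (x - trainPt n D k) r ∧
    1 / (n : ℝ) * ∑ k ∈ Finset.Icc 1 n,
        (s - (trainPt n D k - x) / r ^ 2) ^ 2 * gaussD (x - trainPt n D k) r -
      1 / (n : ℝ) * ∑ k ∈ Finset.Icc 1 n, ∑ j ∈ Finset.Icc 1 n,
        32 / (D / ((n : ℝ) - 1)) ^ 2 *
          gaussD (x - (trainPt n D k + trainPt n D j) / 2) r ≤
      |s - scoreEmp n D (r ^ 2) x| ^ 2 * pEmp n D (r ^ 2) x := by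
  have hn0 : (0 : ℝ) ≤ 1 / (n : ℝ) := by positivity
  have hG := sum_gaussD_pos (by omega : 1 ≤ n) D hr x
  have hid := sum_sq_sub_weighted (Finset.Icc 1 n) (fun k => (trainPt n D k - x) / r ^ 2)
    (fun k => gaussD (x - trainPt n D k) r) s hG.ne'
  have hV0 : 0 ≤ ∑ k ∈ Finset.Icc 1 n, ∑ j ∈ Finset.Icc 1 n,
      ((trainPt n D k - x) / r ^ 2 - (trainPt n D j - x) / r ^ 2) ^ 2 *
        (gaussD (x - trainPt n D k) r * gaussD (x - trainPt n D j) r) /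
        ∑ k ∈ Finset.Icc 1 n, gaussD (x - trainPt n D k) r :=
    Finset.sum_nonneg fun k _ => Finset.sum_nonneg fun j _ => div_nonneg
      (mul_nonneg (sq_nonneg _) (mul_pos (gaussD_pos _ hr) (gaussD_pos _ hr)).le) hG.le
  have hV := sum_variance_le hn hD hr x
  beta_reduce at hid
  rw [← scoreEmp_sq (by omega) D hr x] at hid
  rw [pEmp_sq n D hr, sq_abs, mul_left_comm, ← mul_sub]
  exact ⟨mul_le_mul_of_nonneg_left (by linarith) hn0,
    mul_le_mul_of_nonneg_left (by linarith) hn0⟩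

@[fun_prop]
lemma continuous_limitSqErr (n : ℕ) (κ : ℝ) (k : ℕ) : Continuous (limitSqErr n κ k) := by
  unfold limitSqErr
  split_ifs <;> fun_prop

lemma integrable_max_sq_mul_gaussD {κ : ℝ} (hκ : 0 < κ) :
    Integrable fun u => max (u - κ) 0 ^ 2 * gaussD u 1 := by
  refine (integrable_pow_mul_gaussD_one 2).mono' (by fun_prop) (ae_of_all _ fun u => ?_)
  have hg := gaussD_pos u one_pos
  rw [norm_of_nonneg (by positivity)]
  refine mul_le_mul_of_nonneg_right ?_ hg.le
  rcases le_total (u - κ) 0 with h | h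
  · rw [max_eq_right h]; nlinarith [sq_nonneg u]
  · rw [max_eq_left h]; nlinarith

lemma integral_max_sq_mul_gaussD (κ : ℝ) :
    ∫ u, max (u - κ) 0 ^ 2 * gaussD u 1 = Fgauss κ / 2 := by
  rw [Fgauss, mul_div_cancel_left₀ _ two_ne_zero,
    ← setIntegral_eq_integral_of_forall_compl_eq_zero (s := Set.Ioi κ)]
  · refine setIntegral_congr_fun measurableSet_Ioi fun u hu => ?_
    rw [max_eq_left (sub_nonneg.2 (le_of_lt hu))]
  · intro u hu
    rw [max_eq_right (sub_nonpos.2 (not_lt.1 hu))]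
    ring

lemma integrable_limitSqErr_mul_gaussD (n : ℕ) {κ : ℝ} (hκ : 0 < κ) (k : ℕ) :
    Integrable fun u => limitSqErr n κ k u * gaussD u 1 := by
  have h1 := integrable_max_sq_mul_gaussD hκ
  have h2 := h1.comp_neg
  simp only [gaussD_neg] at h2
  unfold limitSqErr
  split_ifs
  · simpa only [add_mul] using h1.fun_add h2
  · simpa using h1
  · simpa using h2
  · simp

lemma integral_limitSqErr_mul_gaussD (n : ℕ) {κ : ℝ} (hκ : 0 < κ) (k : ℕ) :
    ∫ u, limitSqErr n κ k u * gaussD u 1 =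
      ((if k < n then 1 else 0) + (if 1 < k then 1 else 0)) * (Fgauss κ / 2) := by
  have h1 := integrable_max_sq_mul_gaussD hκ
  have h2 := h1.comp_neg
  have h3 := integral_neg_eq_self (fun u => max (u - κ) 0 ^ 2 * gaussD u 1) volume
  rw [integral_max_sq_mul_gaussD] at h3
  simp only [gaussD_neg] at h2 h3
  unfold limitSqErr
  split_ifs
  · simp only [add_mul]
    rw [integral_add h1 h2, h3, integral_max_sq_mul_gaussD]; ring
  · simp [integral_max_sq_mul_gaussD]
  · simp [h3]
  · simp

lemma sum_integral_limitSqErr {n : ℕ} (hn : 1 ≤ n) {κ : ℝ} (hκ : 0 < κ) :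
    ∑ k ∈ Finset.Icc 1 n, ∫ u, limitSqErr n κ k u * gaussD u 1 = ((n : ℝ) - 1) * Fgauss κ := by
  simp_rw [integral_limitSqErr_mul_gaussD n hκ]
  rw [← Finset.sum_mul, Finset.sum_add_distrib, Finset.sum_boole, Finset.sum_boole]
  have e1 : (Finset.Icc 1 n).filter (fun k => k < n) = Finset.Ico 1 n := by
    ext k; simp only [Finset.mem_filter, Finset.mem_Icc, Finset.mem_Ico]; omega
  have e2 : (Finset.Icc 1 n).filter (fun k => 1 < k) = Finset.Ioc 1 n := by
    ext k; simp only [Finset.mem_filter, Finset.mem_Icc, Finset.mem_Ioc]; omega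
  rw [e1, e2, Nat.card_Ico, Nat.card_Ioc, Nat.cast_sub hn]
  push_cast; ring

lemma integrable_and_abs_integral_sub_le {h q : ℝ → ℝ} (hh : Continuous h) (hq : Continuous q)
    (hqi : Integrable fun u => q u * gaussD u 1) {c : ℝ}
    (hb : ∀ u, |h u - q u| ≤ c * (u ^ 2 + u ^ 4)) :
    Integrable (fun u => h u * gaussD u 1) ∧
      |(∫ u, h u * gaussD u 1) - ∫ u, q u * gaussD u 1| ≤
        c * ∫ u, (u ^ 2 + u ^ 4) * gaussD u 1 := by
  have hM : Integrable fun u : ℝ => c * ((u ^ 2 + u ^ 4) * gaussD u 1) := by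
    simpa only [add_mul] using
      ((integrable_pow_mul_gaussD_one 2).fun_add (integrable_pow_mul_gaussD_one 4)).const_mul c
  have hle : ∀ u, ‖h u * gaussD u 1 - q u * gaussD u 1‖ ≤ c * ((u ^ 2 + u ^ 4) * gaussD u 1) := by
    intro u
    have hg := gaussD_pos u one_pos
    rw [← sub_mul, norm_mul, norm_of_nonneg hg.le, ← mul_assoc]
    exact mul_le_mul_of_nonneg_right (hb u) hg.le
  have hsub : Integrable fun u => h u * gaussD u 1 - q u * gaussD u 1 :=
    hM.mono' (by fun_prop) (ae_of_all _ hle)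
  have hhi : Integrable fun u => h u * gaussD u 1 := by
    simpa using hsub.fun_add hqi
  refine ⟨hhi, ?_⟩
  rw [← integral_sub hhi hqi, ← integral_const_mul]
  exact norm_integral_le_of_norm_le hM (ae_of_all _ hle)

lemma IsShat.integrable_and_abs_sub_le {n : ℕ} (hn : 2 ≤ n) {D κ r : ℝ} (hD : 0 < D) (hκ : 0 < κ)
    (hr : 0 < r) (hκr : κ * r ≤ D / ((n : ℝ) - 1) / 2) {s : ℝ → ℝ}
    (hs : IsShat n D (r ^ 2) (κ * r) s) {k : ℕ} (h1 : 1 ≤ k) (h2 : k ≤ n) :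
    Integrable (fun x => (s x - (trainPt n D k - x) / r ^ 2) ^ 2 * gaussD (x - trainPt n D k) r) ∧
    |r ^ 2 * (∫ x, (s x - (trainPt n D k - x) / r ^ 2) ^ 2 * gaussD (x - trainPt n D k) r) -
        ∫ u, limitSqErr n κ k u * gaussD u 1| ≤
      (6 * κ / (D / ((n : ℝ) - 1)) + (2 + 2 * D / (D / ((n : ℝ) - 1))) ^ 2 / (D / ((n : ℝ) - 1)))
        * r * ∫ u, (u ^ 2 + u ^ 4) * gaussD u 1 := by
  have hc : Continuous s := hs.continuous hn (by positivity)
  obtain ⟨hi, hle⟩ := integrable_and_abs_integral_sub_le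
    (h := fun u => (r * s (r * u + trainPt n D k) + u) ^ 2) (by fun_prop)
    (continuous_limitSqErr n κ k) (integrable_limitSqErr_mul_gaussD n hκ k)
    (hs.abs_sq_sub_limitSqErr_le hn hD hκ hr hκr h1 h2)
  have e : ∀ u, (s (r * u + trainPt n D k) -
      (trainPt n D k - (r * u + trainPt n D k)) / r ^ 2) ^ 2 * gaussD u 1 =
      (r ^ 2)⁻¹ * ((r * s (r * u + trainPt n D k) + u) ^ 2 * gaussD u 1) := fun u => by
    field_simp; ring
  constructor
  · rw [integrable_mul_gaussD_iff (fun x => (s x - (trainPt n D k - x) / r ^ 2) ^ 2) _ hr]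
    simp only [e]
    exact hi.const_mul _
  · rw [integral_mul_gaussD (fun x => (s x - (trainPt n D k - x) / r ^ 2) ^ 2) _ hr]
    simp only [e]
    rwa [integral_const_mul, mul_inv_cancel_left₀ (by positivity)]

lemma IsShat.abs_scoreLoss_sub_le {n : ℕ} (hn : 2 ≤ n) {D κ r : ℝ} (hD : 0 < D) (hκ : 0 < κ)
    (hr : 0 < r) (hκr : κ * r ≤ D / ((n : ℝ) - 1) / 2) {s : ℝ → ℝ}
    (hs : IsShat n D (r ^ 2) (κ * r) s) :
    |scoreLoss n D (r ^ 2) s - ((n : ℝ) - 1) / n * Fgauss κ| ≤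
      (6 * κ / (D / ((n : ℝ) - 1)) + (2 + 2 * D / (D / ((n : ℝ) - 1))) ^ 2 / (D / ((n : ℝ) - 1)))
        * r * (∫ u, (u ^ 2 + u ^ 4) * gaussD u 1) + 32 * n / (D / ((n : ℝ) - 1)) ^ 2 * r ^ 2 := by
  have hc : Continuous s := hs.continuous hn (by positivity)
  have hn0 : (0 : ℝ) < n := by positivity
  have hk := fun k (hk : k ∈ Finset.Icc 1 n) => hs.integrable_and_abs_sub_le hn hD hκ hr hκr
    (Finset.mem_Icc.1 hk).1 (Finset.mem_Icc.1 hk).2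
  have hb := fun x => scoreLoss_integrand_bounds hn hD hr (s x) x
  set c := (6 * κ / (D / ((n : ℝ) - 1)) +
    (2 + 2 * D / (D / ((n : ℝ) - 1))) ^ 2 / (D / ((n : ℝ) - 1))) * r *
      (∫ u, (u ^ 2 + u ^ 4) * gaussD u 1)
  set Q : ℝ → ℝ := fun x => 1 / (n : ℝ) * ∑ k ∈ Finset.Icc 1 n,
    (s x - (trainPt n D k - x) / r ^ 2) ^ 2 * gaussD (x - trainPt n D k) r with hQ
  set W : ℝ → ℝ := fun x => 1 / (n : ℝ) * ∑ k ∈ Finset.Icc 1 n, ∑ j ∈ Finset.Icc 1 n,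
    32 / (D / ((n : ℝ) - 1)) ^ 2 * gaussD (x - (trainPt n D k + trainPt n D j) / 2) r with hW
  set f : ℝ → ℝ := fun x => |s x - scoreEmp n D (r ^ 2) x| ^ 2 * pEmp n D (r ^ 2) x
  have hQi : Integrable Q := (integrable_finsetSum _ fun k hk' => (hk k hk').1).const_mul _
  have hWi : Integrable W := (integrable_finsetSum _ fun k _ => integrable_finsetSum _ fun j _ =>
    (integrable_gaussD _ hr).const_mul _).const_mul _
  have hf0 : ∀ x, 0 ≤ f x := fun x => by
    have := sum_gaussD_pos (by omega : 1 ≤ n) D hr x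
    refine mul_nonneg (by positivity) ?_
    rw [pEmp_sq n D hr]; positivity
  have hfm : Measurable f := by
    have h1 : Measurable (scoreEmp n D (r ^ 2)) := measurable_deriv _
    have h2 : Measurable (pEmp n D (r ^ 2)) := by
      apply Continuous.measurable
      unfold pEmp
      refine continuous_const.mul (continuous_finsetSum _ fun k _ => ?_)
      exact (continuous_gaussD _).comp (continuous_id.sub continuous_const)
    have h3 : Measurable fun x => |s x - scoreEmp n D (r ^ 2) x| :=
      continuous_abs.measurable.comp (hc.measurable.sub h1)
    exact (h3.pow_const 2).mul h2
  have hfi : Integrable f := hQi.mono' hfm.aestronglyMeasurable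
    (ae_of_all _ fun x => by rw [norm_of_nonneg (hf0 x)]; exact (hb x).1)
  have hup : ∫ x, f x ≤ ∫ x, Q x := integral_mono hfi hQi fun x => (hb x).1
  have hlo : (∫ x, Q x) - ∫ x, W x ≤ ∫ x, f x := by
    rw [← integral_sub hQi hWi]
    exact integral_mono (hQi.sub hWi) hfi fun x => (hb x).2
  have hWint : ∫ x, W x = 32 * n / (D / ((n : ℝ) - 1)) ^ 2 := by
    rw [hW, integral_const_mul, integral_finsetSum _ fun k _ => integrable_finsetSum _ fun j _ =>
      (integrable_gaussD _ hr).const_mul _]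
    simp_rw [integral_finsetSum (Finset.Icc 1 n) fun j _ =>
      (integrable_gaussD ((trainPt n D _ + trainPt n D j) / 2) hr).const_mul
        (32 / (D / ((n : ℝ) - 1)) ^ 2), integral_const_mul, integral_gaussD _ hr]
    simp only [Finset.sum_const, Nat.card_Icc, nsmul_eq_mul, Nat.add_sub_cancel]
    field_simp
  have hQint : |r ^ 2 * (∫ x, Q x) - ((n : ℝ) - 1) / n * Fgauss κ| ≤ c := by
    rw [hQ, integral_const_mul, integral_finsetSum _ fun k hk' => (hk k hk').1,
      mul_left_comm, div_mul_eq_mul_div ((n : ℝ) - 1), ← sum_integral_limitSqErr (by omega : 1 ≤ n) hκ,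
      Finset.mul_sum, div_eq_mul_one_div (∑ k ∈ Finset.Icc 1 n, _) (n : ℝ), mul_comm _ (1 / (n : ℝ)), ← mul_sub,
      ← Finset.sum_sub_distrib, abs_mul, abs_of_pos (by positivity)]
    calc _ ≤ 1 / (n : ℝ) * ∑ k ∈ Finset.Icc 1 n, c := by
          refine mul_le_mul_of_nonneg_left ?_ (by positivity)
          exact (Finset.abs_sum_le_sum_abs _ _).trans (Finset.sum_le_sum fun k hk' => (hk k hk').2)
      _ = c := by
        simp only [Finset.sum_const, Nat.card_Icc, nsmul_eq_mul, Nat.add_sub_cancel]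
        field_simp
  have hr2 : 0 < r ^ 2 := by positivity
  have hup' := mul_le_mul_of_nonneg_left hup hr2.le
  have hlo' := mul_le_mul_of_nonneg_left hlo hr2.le
  rw [hWint, mul_sub] at hlo'
  have hL : scoreLoss n D (r ^ 2) s = r ^ 2 * ∫ x, f x := rfl
  have hw : 0 ≤ 32 * n / (D / ((n : ℝ) - 1)) ^ 2 * r ^ 2 := by positivity
  rw [abs_le] at hQint ⊢
  rw [hL]
  constructor <;> linarith

/-- With `δ_t = κ√t`, there are `t₁, C > 0` (depending only on `κ, n, D`)
such that for all `t ∈ (0, t₁)`, `δ_t ∈ (0, Δ)` and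
`((n-1)/n)F(κ) - C√t ≤ L_t[ŝ_{t,δ_t}] ≤ ((n-1)/n)F(κ) + C√t`. -/
theorem stmt_0 (n : ℕ) (hn : 2 ≤ n) (D : ℝ) (hD : 0 < D) (κ : ℝ) (hκ : 0 < κ) :
    ∃ t₁ > (0 : ℝ), ∃ C > (0 : ℝ), ∀ t ∈ Set.Ioo 0 t₁,
      κ * Real.sqrt t ∈ Set.Ioo 0 (D / ((n : ℝ) - 1)) ∧
      ∀ s : ℝ → ℝ, IsShat n D t (κ * Real.sqrt t) s →
        ((n : ℝ) - 1) / n * Fgauss κ - C * Real.sqrt t ≤ scoreLoss n D t s ∧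
        scoreLoss n D t s ≤ ((n : ℝ) - 1) / n * Fgauss κ + C * Real.sqrt t := by
  have hE := spacing_pos hn hD
  set E := D / ((n : ℝ) - 1) with hEd
  set M := ∫ u, (u ^ 2 + u ^ 4) * gaussD u 1 with hM
  have hM0 : 0 ≤ M := integral_nonneg fun u => by
    have := gaussD_pos u one_pos
    simp only [Pi.zero_apply]
    positivity
  have hn0 : (0 : ℝ) < n := by positivity
  refine ⟨(min 1 (E / (2 * κ))) ^ 2, by positivity,
    (6 * κ / E + (2 + 2 * D / E) ^ 2 / E) * M + 32 * n / E ^ 2, by positivity, fun t ht => ?_⟩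
  obtain ⟨r, hr, rfl⟩ : ∃ r, 0 < r ∧ t = r ^ 2 :=
    ⟨√t, Real.sqrt_pos.2 ht.1, (Real.sq_sqrt ht.1.le).symm⟩
  rw [Real.sqrt_sq hr.le]
  have hlt : r < min 1 (E / (2 * κ)) := lt_of_pow_lt_pow_left₀ 2 (by positivity) ht.2
  have hr1 : r < 1 := hlt.trans_le (min_le_left _ _)
  have hκr : κ * r ≤ E / 2 := by
    have := hlt.trans_le (min_le_right _ _)
    rw [lt_div_iff₀ (by positivity)] at this
    linarith
  refine ⟨⟨by positivity, by linarith⟩, fun s hs => ?_⟩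
  have h := hs.abs_scoreLoss_sub_le hn hD hκ hr hκr
  rw [← hEd, ← hM, abs_le] at h
  have h2 : 32 * n / E ^ 2 * r ^ 2 ≤ 32 * n / E ^ 2 * r :=
    mul_le_mul_of_nonneg_left (by nlinarith) (by positivity)
  constructor <;> linarith
end

section
/- Let 0 < ε < 0.03, let N ⊂ ℝ be a finite set, and suppose f: ℝ → ℝ is continuous, differentiable at every point of ℝ \ N, and satisfies ∫_{−3}^{3} |x + f(x)|² p_N(x; 1) dx < ε. Then: (i) inf_{x ∈ [−1.5, 1.5] \ N} f′(x) ≤ −1 + 2√ε; (ii) inf_{x ∈ [1.5, 3]} f(x) ≤ −0.5; and (iii) sup_{x ∈ [−3, −1.5]} f(x) ≥ 0.5. -/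
open MeasureTheory Real Set

/-- A continuous function whose derivative is nonnegative off a finite set takes ordered values
at the endpoints of an interval. -/
theorem le_of_deriv_nonneg_off_finite {h : ℝ → ℝ} (hc : Continuous h) {N : Set ℝ}
    (hN : N.Finite) : ∀ a b : ℝ, a ≤ b →
    (∀ x ∈ Ioo a b \ N, DifferentiableAt ℝ h x ∧ 0 ≤ deriv h x) → h a ≤ h b := by
  induction N, hN using Set.Finite.induction_on with
  | empty =>
    intro a b hab hd
    refine monotoneOn_of_deriv_nonneg (convex_Icc a b) hc.continuousOn ?_ ?_
      (left_mem_Icc.2 hab) (right_mem_Icc.2 hab) hab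
    · intro x hx
      rw [interior_Icc] at hx
      exact (hd x ⟨hx, id⟩).1.differentiableWithinAt
    · intro x hx
      rw [interior_Icc] at hx
      exact (hd x ⟨hx, id⟩).2
  | @insert c s _ _ ih =>
    intro a b hab hd
    by_cases hcm : c ∈ Ioo a b
    · refine (ih a c hcm.1.le fun x hx => hd x ⟨⟨hx.1.1, hx.1.2.trans hcm.2⟩, ?_⟩).trans
        (ih c b hcm.2.le fun x hx => hd x ⟨⟨hcm.1.trans hx.1.1, hx.1.2⟩, ?_⟩)
      · rintro (rfl | hs)
        · exact lt_irrefl _ hx.1.2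
        · exact hx.2 hs
      · rintro (rfl | hs)
        · exact lt_irrefl _ hx.1.1
        · exact hx.2 hs
    · refine ih a b hab fun x hx => hd x ⟨hx.1, ?_⟩
      rintro (rfl | hs)
      · exact hcm hx.1
      · exact hx.2 hs

/-- A continuous pointwise lower bound for the unnormalized weighted square error on a subinterval
of `[-3, 3]` has integral controlled by the loss. -/
theorem integral_lt_of_loss_lt {f q : ℝ → ℝ} {ε a b : ℝ} (hε : 0 < ε) (hf : Continuous f)
    (hloss : (∫ x in Icc (-3 : ℝ) 3, |x + f x| ^ 2 * gaussD x 1) < ε)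
    (ha : -3 ≤ a) (hab : a ≤ b) (hb : b ≤ 3) (hq : Continuous q)
    (hle : ∀ x ∈ Icc a b, q x ≤ (x + f x) ^ 2 * exp (-x ^ 2 / 2)) :
    (∫ x in a..b, q x) < 2.51 * ε := by
  have hcont : Continuous fun x => (x + f x) ^ 2 * exp (-x ^ 2 / 2) := by fun_prop
  have hpos : 0 < √(2 * π) := by positivity
  have hsqrt : √(2 * π) ≤ 2.51 := by
    rw [Real.sqrt_le_left (by norm_num)]
    have := Real.pi_lt_d2
    norm_num at this ⊢
    linarith
  have hwhole : (∫ x in Icc (-3 : ℝ) 3, (x + f x) ^ 2 * exp (-x ^ 2 / 2)) < √(2 * π) * ε := by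
    have heq : ∀ x, |x + f x| ^ 2 * gaussD x 1 =
        (√(2 * π))⁻¹ * ((x + f x) ^ 2 * exp (-x ^ 2 / 2)) := by
      intro x
      simp only [gaussD, sq_abs, mul_one, one_pow]
      ring
    simp only [heq] at hloss
    rw [integral_const_mul, inv_mul_lt_iff₀ hpos] at hloss
    exact hloss
  calc (∫ x in a..b, q x) ≤ ∫ x in a..b, (x + f x) ^ 2 * exp (-x ^ 2 / 2) :=
        intervalIntegral.integral_mono_on hab (hq.intervalIntegrable _ _)
          (hcont.intervalIntegrable _ _) hle
    _ = ∫ x in Icc a b, (x + f x) ^ 2 * exp (-x ^ 2 / 2) := by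
        rw [intervalIntegral.integral_of_le hab, integral_Icc_eq_integral_Ioc]
    _ ≤ ∫ x in Icc (-3 : ℝ) 3, (x + f x) ^ 2 * exp (-x ^ 2 / 2) :=
        setIntegral_mono_set hcont.integrableOn_Icc
          (Filter.Eventually.of_forall fun x => by positivity)
          (Icc_subset_Icc ha hb).eventuallyLE
    _ < √(2 * π) * ε := hwhole
    _ ≤ 2.51 * ε := by gcongr

theorem const_le_exp_neg_sq_div_two {x : ℝ} (hx : x ^ 2 ≤ 4) : 0.1 ≤ exp (-x ^ 2 / 2) := by
  have h := Real.add_one_le_exp (-x ^ 2 / 2 / 8)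
  calc (0.1 : ℝ) ≤ (3 / 4) ^ 8 := by norm_num
    _ ≤ exp (-x ^ 2 / 2 / 8) ^ 8 := by gcongr; linarith
    _ = exp (-x ^ 2 / 2) := by rw [← Real.exp_nat_mul]; congr 1; push_cast; ring

theorem one_sub_sq_div_four_sq_le_exp {x : ℝ} (hx : x ^ 2 ≤ 4) :
    (1 - x ^ 2 / 4) ^ 2 ≤ exp (-x ^ 2 / 2) := by
  have h := Real.add_one_le_exp (-x ^ 2 / 4)
  calc (1 - x ^ 2 / 4) ^ 2 ≤ exp (-x ^ 2 / 4) ^ 2 := by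
        gcongr
        · linarith
        · linarith
    _ = exp (-x ^ 2 / 2) := by rw [← Real.exp_nat_mul]; congr 1; push_cast; ring

/-- if `f` is continuous, differentiable off a finite set `N`, and
`∫_{-3}^3 |x + f(x)|² p_N(x;1) dx < ε` with `0 < ε < 0.03`, then (i) the infimum of `f'`
over `[-1.5,1.5] \ N` is at most `-1 + 2√ε`, (ii) the infimum of `f` over `[1.5,3]` is at
most `-0.5`, and (iii) the supremum of `f` over `[-3,-1.5]` is at least `0.5`. -/
theorem stmt_4 (ε : ℝ) (hε : ε ∈ Set.Ioo (0 : ℝ) 0.03)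
    (N : Set ℝ) (hN : N.Finite) (f : ℝ → ℝ) (hf : Continuous f)
    (hdiff : ∀ x ∉ N, DifferentiableAt ℝ f x)
    (hloss : (∫ x in Set.Icc (-3 : ℝ) 3, |x + f x| ^ 2 * gaussD x 1) < ε) :
    (⨅ x ∈ Set.Icc (-1.5 : ℝ) 1.5 \ N, ((deriv f x : ℝ) : EReal)) ≤
        ((-1 + 2 * Real.sqrt ε : ℝ) : EReal) ∧
    (⨅ x ∈ Set.Icc (1.5 : ℝ) 3, ((f x : ℝ) : EReal)) ≤ ((-0.5 : ℝ) : EReal) ∧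
    ((0.5 : ℝ) : EReal) ≤ ⨆ x ∈ Set.Icc (-3 : ℝ) (-1.5), ((f x : ℝ) : EReal) := by
  obtain ⟨hε0, hε1⟩ := hε
  refine ⟨?_, ?_, ?_⟩
  · by_contra! hcon
    set m := 2 * √ε with hm
    have hm0 : 0 ≤ m := by positivity
    have hm2 : m ^ 2 = 4 * ε := by rw [hm, mul_pow, Real.sq_sqrt hε0.le]; ring
    have hderiv : ∀ x ∈ Icc (-1.5 : ℝ) 1.5 \ N, -1 + m ≤ deriv f x := fun x hx =>
      EReal.coe_le_coe_iff.1 (hcon.le.trans (iInf₂_le x hx))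
    have hmono : ∀ a b : ℝ, -1.5 ≤ a → a ≤ b → b ≤ 1.5 →
        f a + (1 - m) * a ≤ f b + (1 - m) * b := by
      intro a b ha hab hb
      refine le_of_deriv_nonneg_off_finite (h := fun x => f x + (1 - m) * x) (by fun_prop) hN a b
        hab fun x hx => ?_
      have hd : HasDerivAt (fun x => f x + (1 - m) * x) (deriv f x + (1 - m) * 1) x :=
        (hdiff x hx.2).hasDerivAt.add ((hasDerivAt_id x).const_mul (1 - m))
      refine ⟨hd.differentiableAt, ?_⟩
      rw [hd.deriv]
      have := hderiv x ⟨⟨ha.trans hx.1.1.le, hx.1.2.le.trans hb⟩, hx.2⟩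
      linarith
    have key := integral_lt_of_loss_lt
      (q := fun x => (2 * m * f 0 * x + m ^ 2 * x ^ 2) * (1 - x ^ 2 / 4) ^ 2)
      (a := -3 / 2) (b := 3 / 2) hε0 hf hloss (by norm_num) (by norm_num) (by norm_num)
      (by fun_prop) (by
        intro x ⟨hx1, hx2⟩
        have hx4 : x ^ 2 ≤ 4 := by nlinarith
        have hxg : m * x ^ 2 ≤ x * (x + f x - f 0) := by
          rcases le_total 0 x with h | h
          · have := hmono 0 x (by norm_num) h (by norm_num; linarith)
            nlinarith
          · have := hmono x 0 (by norm_num; linarith) h (by norm_num)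
            nlinarith
        have hle : 2 * m * f 0 * x + m ^ 2 * x ^ 2 ≤ (x + f x) ^ 2 := by
          nlinarith [sq_nonneg (x + f x - m * x), mul_le_mul_of_nonneg_left hxg hm0]
        exact mul_le_mul hle (one_sub_sq_div_four_sq_le_exp hx4) (sq_nonneg _) (sq_nonneg _))
    have hF : ∀ x : ℝ, HasDerivAt (fun x => 2 * m * f 0 * (x ^ 2 / 2 - x ^ 4 / 8 + x ^ 6 / 96) +
        m ^ 2 * (x ^ 3 / 3 - x ^ 5 / 10 + x ^ 7 / 112))
        ((2 * m * f 0 * x + m ^ 2 * x ^ 2) * (1 - x ^ 2 / 4) ^ 2) x := by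
      intro x
      have h (n : ℕ) := hasDerivAt_pow n x
      refine ((((((h 2).div_const 2).sub ((h 4).div_const 8)).add
        ((h 6).div_const 96)).const_mul (2 * m * f 0)).add
        (((((h 3).div_const 3).sub ((h 5).div_const 10)).add
        ((h 7).div_const 112)).const_mul (m ^ 2))).congr_deriv ?_
      norm_num
      ring
    rw [intervalIntegral.integral_eq_sub_of_hasDerivAt (fun x _ => hF x)
      (Continuous.intervalIntegrable (by fun_prop) _ _), hm2] at key
    norm_num at key
    linarith
  · by_contra! hcon
    have hval : ∀ x ∈ Icc (1.5 : ℝ) 3, -0.5 ≤ f x := fun x hx =>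
      EReal.coe_le_coe_iff.1 (hcon.le.trans (iInf₂_le x hx))
    have key := integral_lt_of_loss_lt (q := fun x => (x - 1 / 2) ^ 2 * 0.1)
      (a := 3 / 2) (b := 2) hε0 hf hloss (by norm_num) (by norm_num) (by norm_num)
      (by fun_prop) (by
        intro x ⟨hx1, hx2⟩
        have := hval x ⟨by norm_num; linarith, by linarith⟩
        norm_num at this
        have hle : (x - 1 / 2) ^ 2 ≤ (x + f x) ^ 2 := by nlinarith
        exact mul_le_mul hle (const_le_exp_neg_sq_div_two (by nlinarith)) (by norm_num)
          (sq_nonneg _))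
    have hintegral : (∫ x in (3 / 2 : ℝ)..2, (x - 1 / 2) ^ 2 * 0.1) = 19 / 240 := by
      rw [intervalIntegral.integral_mul_const,
        intervalIntegral.integral_comp_sub_right (fun x => x ^ 2) (1 / 2), integral_pow]
      norm_num
    rw [hintegral] at key
    norm_num at key hε1
    linarith
  · by_contra! hcon
    have hval : ∀ x ∈ Icc (-3 : ℝ) (-1.5), f x ≤ 0.5 := fun x hx =>
      EReal.coe_le_coe_iff.1 ((le_iSup₂ (f := fun x (_ : x ∈ Icc (-3 : ℝ) (-1.5)) =>
        ((f x : ℝ) : EReal)) x hx).trans hcon.le)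
    have key := integral_lt_of_loss_lt (q := fun x => (x + 1 / 2) ^ 2 * 0.1)
      (a := -2) (b := -3 / 2) hε0 hf hloss (by norm_num) (by norm_num) (by norm_num)
      (by fun_prop) (by
        intro x ⟨hx1, hx2⟩
        have := hval x ⟨by linarith, by norm_num; linarith⟩
        norm_num at this
        have hle : (x + 1 / 2) ^ 2 ≤ (x + f x) ^ 2 := by nlinarith
        exact mul_le_mul hle (const_le_exp_neg_sq_div_two (by nlinarith)) (by norm_num)
          (sq_nonneg _))
    have hintegral : (∫ x in (-2 : ℝ)..(-3 / 2), (x + 1 / 2) ^ 2 * 0.1) = 19 / 240 := by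
      rw [intervalIntegral.integral_mul_const,
        intervalIntegral.integral_comp_add_right (fun x => x ^ 2) (1 / 2), integral_pow]
      norm_num
    rw [hintegral] at key
    norm_num at key hε1
    linarith
end

section
/- For every κ > 0, every t ∈ (0, 1/κ²), and every x ∈ ℝ, the curve u ↦ x_u := φ_{u|t}(x), defined for u ∈ [0, t], satisfies: x_t = x; x_u is differentiable in u on (0, t] with d x_u/du = −(1/2) ŝ_{u,δ_u}(x_u) for all u ∈ (0, t]; and u ↦ x_u is continuous at u = 0 with x_0 = φ_{0|t}(x), where φ_{0|t}(x) = x/(1 − δ_t) if |x| ≤ 1 − δ_t and φ_{0|t}(x) = sgn(x) otherwise. -/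
open MeasureTheory Real Set Filter
open scoped ENNReal

/-- The smoothed piecewise-linear empirical score function `ŝ_{t,δ}` for the
training set `{-1, +1}`. -/
noncomputable def shat2 (t δ x : ℝ) : ℝ :=
  if x ≤ δ - 1 then -(x + 1) / t
  else if 1 - δ ≤ x then -(x - 1) / t
  else (δ / (1 - δ)) * x / t

/-- The flow map `φ_{s|t}` of the denoising dynamics under `ŝ` with `δ_u = κ√u`,
for the training set `{-1, +1}`. -/
noncomputable def phiFlow (κ s t x : ℝ) : ℝ :=
  if x ≤ κ * Real.sqrt t - 1 then
    Real.sqrt (s / t) * x - (1 - Real.sqrt (s / t))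
  else if 1 - κ * Real.sqrt t ≤ x then
    Real.sqrt (s / t) * x + (1 - Real.sqrt (s / t))
  else ((1 - κ * Real.sqrt s) / (1 - κ * Real.sqrt t)) * x

lemma phiFlow_of_le {κ t x : ℝ} (ht : 0 ≤ t) (hx : x ≤ κ * √t - 1) (v : ℝ) :
    phiFlow κ v t x = √v * ((x + 1) / √t) - 1 := by
  rw [phiFlow, if_pos hx, Real.sqrt_div' v ht]
  ring

lemma phiFlow_of_ge {κ t x : ℝ} (ht : 0 ≤ t) (hδ : κ * √t < 1) (hx : 1 - κ * √t ≤ x) (v : ℝ) :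
    phiFlow κ v t x = √v * ((x - 1) / √t) + 1 := by
  rw [phiFlow, if_neg (by linarith), if_pos hx, Real.sqrt_div' v ht]
  ring

lemma phiFlow_of_mem_Ioo {κ t x : ℝ} (hx : x ∈ Ioo (κ * √t - 1) (1 - κ * √t)) (v : ℝ) :
    phiFlow κ v t x = √v * (-κ * (x / (1 - κ * √t))) + x / (1 - κ * √t) := by
  rw [phiFlow, if_neg (not_le.2 hx.1), if_neg (not_le.2 hx.2)]
  ring

/-- For every `x`, the curve `v ↦ φ_{v|t}(x)` is affine in `√v`. -/
lemma exists_phiFlow_eq_sqrt_mul_add {κ t : ℝ} (ht : 0 ≤ t) (hδ : κ * √t < 1) (x : ℝ) :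
    ∃ a b : ℝ, ∀ v, phiFlow κ v t x = √v * a + b := by
  by_cases h₁ : x ≤ κ * √t - 1
  · exact ⟨_, -1, phiFlow_of_le ht h₁⟩
  by_cases h₂ : 1 - κ * √t ≤ x
  · exact ⟨_, _, phiFlow_of_ge ht hδ h₂⟩
  · exact ⟨_, _, phiFlow_of_mem_Ioo ⟨not_le.1 h₁, not_le.1 h₂⟩⟩

lemma continuous_phiFlow {κ t : ℝ} (ht : 0 ≤ t) (hδ : κ * √t < 1) (x : ℝ) :
    Continuous fun v => phiFlow κ v t x := by
  obtain ⟨a, b, h⟩ := exists_phiFlow_eq_sqrt_mul_add ht hδ x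
  simp only [h]
  fun_prop

lemma phiFlow_self {κ t : ℝ} (ht : 0 < t) (hδ : κ * √t < 1) (x : ℝ) :
    phiFlow κ t t x = x := by
  rw [phiFlow, div_self ht.ne', div_self (sub_pos.2 hδ).ne', Real.sqrt_one]
  split_ifs <;> ring

lemma phiFlow_zero {κ t : ℝ} (hδ : κ * √t < 1) (x : ℝ) :
    phiFlow κ 0 t x =
      if |x| ≤ 1 - κ * √t then x / (1 - κ * √t) else Real.sign x := by
  have hpos : 0 < 1 - κ * √t := sub_pos.2 hδ
  simp only [phiFlow, zero_div, Real.sqrt_zero, mul_zero, zero_mul, sub_zero, zero_sub, zero_add]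
  split_ifs with h₁ h₂ h₃ h₄ h₅
  · rw [eq_div_iff hpos.ne']
    linarith [(abs_le.1 h₂).1]
  · rw [Real.sign_of_neg (by linarith)]
  · rw [eq_div_iff hpos.ne']
    linarith [(abs_le.1 h₄).2]
  · rw [Real.sign_of_pos (by linarith)]
  · ring
  · exact absurd (abs_le.2 ⟨by linarith, by linarith⟩) h₅

lemma shat2_phiFlow_of_le {κ t u x : ℝ} (ht : 0 < t) (hx : x ≤ κ * √t - 1) :
    shat2 u (κ * √u) (phiFlow κ u t x) = -(√u * ((x + 1) / √t)) / u := by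
  have hle : (x + 1) / √t ≤ κ := (div_le_iff₀ (Real.sqrt_pos.2 ht)).2 (by linarith)
  have := mul_le_mul_of_nonneg_left hle (Real.sqrt_nonneg u)
  rw [phiFlow_of_le ht.le hx, shat2, if_pos (by linarith)]
  ring

lemma shat2_phiFlow_of_ge {κ t u x : ℝ} (ht : 0 < t) (hδ : κ * √t < 1) (hδu : κ * √u < 1)
    (hx : 1 - κ * √t ≤ x) :
    shat2 u (κ * √u) (phiFlow κ u t x) = -(√u * ((x - 1) / √t)) / u := by
  have hle : -κ ≤ (x - 1) / √t := (le_div_iff₀ (Real.sqrt_pos.2 ht)).2 (by linarith)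
  have := mul_le_mul_of_nonneg_left hle (Real.sqrt_nonneg u)
  rw [phiFlow_of_ge ht.le hδ hx, shat2, if_neg (by linarith), if_pos (by linarith)]
  ring

lemma shat2_phiFlow_of_mem_Ioo {κ t u x : ℝ} (hδ : κ * √t < 1) (hδu : κ * √u < 1)
    (hx : x ∈ Ioo (κ * √t - 1) (1 - κ * √t)) :
    shat2 u (κ * √u) (phiFlow κ u t x) = κ * √u * (x / (1 - κ * √t)) / u := by
  have hpos : 0 < 1 - κ * √t := sub_pos.2 hδ
  have hupos : 0 < 1 - κ * √u := sub_pos.2 hδu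
  have hlt : x / (1 - κ * √t) < 1 := (div_lt_one hpos).2 hx.2
  have hgt : -1 < x / (1 - κ * √t) := (lt_div_iff₀ hpos).2 (by linarith [hx.1])
  rw [phiFlow_of_mem_Ioo hx]
  set y := x / (1 - κ * √t)
  have hy : √u * (-κ * y) + y = (1 - κ * √u) * y := by ring
  have h₁ := mul_lt_mul_of_pos_left hlt hupos
  have h₂ := mul_lt_mul_of_pos_left hgt hupos
  rw [hy, shat2, if_neg (by linarith), if_neg (by linarith), ← mul_assoc,
    div_mul_cancel₀ _ hupos.ne']

lemma hasDerivAt_sqrt_mul_add {u : ℝ} (hu : 0 < u) (a b : ℝ) :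
    HasDerivAt (fun v => √v * a + b) (1 / 2 * (√u * a / u)) u := by
  refine (((Real.hasDerivAt_sqrt hu.ne').mul_const a).add_const b).congr_deriv ?_
  have hs : √u ≠ 0 := (Real.sqrt_pos.2 hu).ne'
  field_simp
  rw [Real.sq_sqrt hu.le, mul_comm]

/-- The flow map solves the denoising ODE driven by the smoothed score. -/
lemma hasDerivAt_phiFlow {κ t u : ℝ} (ht : 0 < t) (hu : 0 < u) (hδ : κ * √t < 1)
    (hδu : κ * √u < 1) (x : ℝ) :
    HasDerivAt (fun v => phiFlow κ v t x)
      (-(1 / 2) * shat2 u (κ * √u) (phiFlow κ u t x)) u := by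
  by_cases h₁ : x ≤ κ * √t - 1
  · rw [shat2_phiFlow_of_le ht h₁, funext (phiFlow_of_le ht.le h₁)]
    exact (hasDerivAt_sqrt_mul_add hu ((x + 1) / √t) (-1)).congr_deriv (by ring)
  by_cases h₂ : 1 - κ * √t ≤ x
  · rw [shat2_phiFlow_of_ge ht hδ hδu h₂, funext (phiFlow_of_ge ht.le hδ h₂)]
    exact (hasDerivAt_sqrt_mul_add hu ((x - 1) / √t) 1).congr_deriv (by ring)
  · have hx : x ∈ Ioo (κ * √t - 1) (1 - κ * √t) := ⟨not_le.1 h₁, not_le.1 h₂⟩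
    rw [shat2_phiFlow_of_mem_Ioo hδ hδu hx, funext (phiFlow_of_mem_Ioo hx)]
    exact (hasDerivAt_sqrt_mul_add hu _ _).congr_deriv (by ring)

lemma mul_sqrt_lt_one {κ t : ℝ} (hκ : 0 < κ) (ht : t < 1 / κ ^ 2) : κ * √t < 1 := by
  rw [mul_comm, ← lt_div_iff₀ hκ, Real.sqrt_lt' (by positivity), div_pow, one_pow]
  exact ht

/-- the curve `u ↦ φ_{u|t}(x)` on `[0,t]` solves the smoothed denoising ODE
`dx_u/du = -(1/2) ŝ_{u,δ_u}(x_u)` on `(0,t]`, has terminal value `x` at `u = t`, and is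
continuous at `u = 0` with value `φ_{0|t}(x)`. -/
theorem stmt_7 (κ : ℝ) (hκ : 0 < κ) (t : ℝ) (ht : t ∈ Set.Ioo 0 (1 / κ ^ 2)) (x : ℝ) :
    phiFlow κ t t x = x ∧
    (∀ u ∈ Set.Ioc 0 t,
      HasDerivWithinAt (fun v => phiFlow κ v t x)
        (-(1 / 2) * shat2 u (κ * Real.sqrt u) (phiFlow κ u t x)) (Set.Ioc 0 t) u) ∧
    ContinuousWithinAt (fun v => phiFlow κ v t x) (Set.Icc 0 t) 0 ∧
    phiFlow κ 0 t x =
      (if |x| ≤ 1 - κ * Real.sqrt t then x / (1 - κ * Real.sqrt t) else Real.sign x) := by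
  have hδ := mul_sqrt_lt_one hκ ht.2
  refine ⟨phiFlow_self ht.1 hδ x, fun u hu => ?_,
    (continuous_phiFlow ht.1.le hδ x).continuousWithinAt, phiFlow_zero hδ x⟩
  have hδu := mul_sqrt_lt_one hκ (hu.2.trans_lt ht.2)
  exact (hasDerivAt_phiFlow ht.1 hu.1 hδ hδu x).hasDerivWithinAt
end

section
/- Let κ > 0 and let t > 0 satisfy δ_t = κ√t < Δ. For every x ∈ ℝ, the curve u ↦ x_u := ψ_{u|t}(x), defined for u ∈ (0, t], satisfies x_t = x and is differentiable in u on (0, t] with d x_u/du = −(1/2) ŝ_{u,δ_u}(x_u) for all u ∈ (0, t]. -/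
open MeasureTheory Real Set Filter
open scoped ENNReal

/-- The flow map `ψ_{s|t}` of the smoothed denoising dynamics for `n` uniformly spaced
training points (as a predicate characterizing it by its defining piecewise formulas,
with `δ_u = κ√u`, `Δ = D/(n-1)`, `z_k = y_k + Δ`). -/
def IsPsiFlow (n : ℕ) (D κ s t : ℝ) (g : ℝ → ℝ) : Prop :=
  (∀ x ≤ trainPt n D 1 + κ * Real.sqrt t,
    g x = Real.sqrt (s / t) * (x - trainPt n D 1) + trainPt n D 1) ∧
  (∀ x, trainPt n D n - κ * Real.sqrt t ≤ x →
    g x = Real.sqrt (s / t) * (x - trainPt n D n) + trainPt n D n) ∧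
  (∀ k, 2 ≤ k → k ≤ n - 1 →
    ∀ x ∈ Set.Icc (trainPt n D k - κ * Real.sqrt t) (trainPt n D k + κ * Real.sqrt t),
      g x = Real.sqrt (s / t) * (x - trainPt n D k) + trainPt n D k) ∧
  (∀ k, 1 ≤ k → k ≤ n - 1 →
    ∀ x ∈ Set.Icc (trainPt n D k + κ * Real.sqrt t) (trainPt n D (k + 1) - κ * Real.sqrt t),
      g x = ((D / ((n : ℝ) - 1) - κ * Real.sqrt s) / (D / ((n : ℝ) - 1) - κ * Real.sqrt t)) *
          (x - (trainPt n D k + D / ((n : ℝ) - 1))) + (trainPt n D k + D / ((n : ℝ) - 1)))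

/-- Every point strictly between `y 1 + δ` and `y m - δ` lies in a gap between consecutive
neighbourhoods of radius `δ`, or in the neighbourhood of an interior node. -/
lemma exists_gap_or_node (y : ℕ → ℝ) {δ x : ℝ} (hδ : 0 ≤ δ) (h1 : y 1 + δ < x) (m : ℕ)
    (hm : 1 ≤ m) (hx : x < y m - δ) :
    ∃ k, 1 ≤ k ∧ k + 1 ≤ m ∧ (x ∈ Set.Icc (y k + δ) (y (k + 1) - δ) ∨
      (2 ≤ k ∧ x ∈ Set.Icc (y k - δ) (y k + δ))) := by
  induction m, hm using Nat.le_induction with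
  | base => linarith
  | succ m hm ih =>
    rcases lt_or_ge x (y m - δ) with h | h
    · obtain ⟨k, hk, hkm, hc⟩ := ih h
      exact ⟨k, hk, by omega, hc⟩
    · refine ⟨m, hm, le_rfl, ?_⟩
      rcases le_or_gt x (y m + δ) with h' | h'
      · refine Or.inr ⟨?_, h, h'⟩
        by_contra hlt
        obtain rfl : m = 1 := by omega
        linarith
      · exact Or.inl ⟨h'.le, hx.le⟩

lemma hasDerivAt_sqrt_div_flow {u t : ℝ} (hu : 0 < u) (ht : 0 ≤ t) (y x : ℝ) :
    HasDerivAt (fun v => √(v / t) * (x - y) + y)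
      (-(1 / 2) * ((y - (√(u / t) * (x - y) + y)) / u)) u := by
  have h := (((Real.hasDerivAt_sqrt hu.ne').div_const (√t)).mul_const (x - y)).add_const y
  simp only [Real.sqrt_div' _ ht]
  refine h.congr_deriv ?_
  have hs : 0 < √u := Real.sqrt_pos.2 hu
  have hu2 : u = √u * √u := (Real.mul_self_sqrt hu.le).symm
  generalize √u = r at *
  subst hu2
  field_simp
  ring

lemma hasDerivAt_affine_flow {u κ Δ A : ℝ} (hu : 0 < u) (ha : κ * √u < Δ) (z x : ℝ) :
    HasDerivAt (fun v => (Δ - κ * √v) / A * (x - z) + z)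
      (-(1 / 2) * (κ * √u / (Δ - κ * √u) *
        ((Δ - κ * √u) / A * (x - z) + z - z) / u)) u := by
  have h := (((((Real.hasDerivAt_sqrt hu.ne').const_mul κ).const_sub Δ).div_const A).mul_const
    (x - z)).add_const z
  refine h.congr_deriv ?_
  have hs : 0 < √u := Real.sqrt_pos.2 hu
  have ha' : Δ - κ * √u ≠ 0 := by linarith
  have hu2 : u = √u * √u := (Real.mul_self_sqrt hu.le).symm
  generalize √u = r at *
  subst hu2
  field_simp
  ring

/-- for `δ_t = κ√t < Δ`, the curve `u ↦ ψ_{u|t}(x)` on `(0,t]` has terminal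
value `x` at `u = t` and solves the smoothed denoising ODE `dx_u/du = -(1/2) ŝ_{u,δ_u}(x_u)`
on `(0,t]`. -/
theorem stmt_9 (n : ℕ) (hn : 2 ≤ n) (D : ℝ) (hD : 0 < D) (κ : ℝ) (hκ : 0 < κ)
    (t : ℝ) (ht : 0 < t) (hδ : κ * Real.sqrt t < D / ((n : ℝ) - 1))
    (ψ : ℝ → ℝ → ℝ) (hψ : ∀ u ∈ Set.Icc 0 t, IsPsiFlow n D κ u t (ψ u))
    (S : ℝ → ℝ → ℝ) (hS : ∀ u ∈ Set.Ioc 0 t, IsShat n D u (κ * Real.sqrt u) (S u)) (x : ℝ) :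
    ψ t x = x ∧
    ∀ u ∈ Set.Ioc 0 t,
      HasDerivWithinAt (fun v => ψ v x) (-(1 / 2) * S u (ψ u x)) (Set.Ioc 0 t) u := by
  set Δ := D / ((n : ℝ) - 1)
  have hst : 0 < √t := Real.sqrt_pos.2 ht
  -- Multiplication by `√(u / t)` rescales the `κ√t`-neighbourhoods onto the `κ√u`-neighbourhoods.
  have hrad : ∀ u, √(u / t) * (κ * √t) = κ * √u := fun u => by
    rw [Real.sqrt_div' _ ht.le]
    field_simp
  have htt : √(t / t) = 1 := by rw [div_self ht.ne', Real.sqrt_one]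
  have node : ∀ y : ℝ, (∀ v ∈ Set.Icc 0 t, ψ v x = √(v / t) * (x - y) + y) →
      (∀ u ∈ Set.Ioc 0 t, S u (ψ u x) = (y - ψ u x) / u) →
      ψ t x = x ∧ ∀ u ∈ Set.Ioc 0 t,
        HasDerivWithinAt (fun v => ψ v x) (-(1 / 2) * S u (ψ u x)) (Set.Ioc 0 t) u := by
    intro y hf hs
    refine ⟨by rw [hf t ⟨ht.le, le_rfl⟩, htt]; ring, fun u hu => ?_⟩
    rw [hs u hu, hf u (Set.Ioc_subset_Icc_self hu)]
    exact (hasDerivAt_sqrt_div_flow hu.1 ht.le y x).hasDerivWithinAt.congr_of_mem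
      (fun v hv => hf v (Set.Ioc_subset_Icc_self hv)) hu
  have hle : ∀ u y, x - y ≤ κ * √t → √(u / t) * (x - y) ≤ κ * √u := fun u y h =>
    hrad u ▸ mul_le_mul_of_nonneg_left h (Real.sqrt_nonneg _)
  have hge : ∀ u y, -(κ * √t) ≤ x - y → -(κ * √u) ≤ √(u / t) * (x - y) := fun u y h => by
    rw [← hrad u, ← mul_neg]
    exact mul_le_mul_of_nonneg_left h (Real.sqrt_nonneg _)
  rcases le_or_gt x (trainPt n D 1 + κ * √t) with h1 | h1
  · have hf := fun v hv => (hψ v hv).1 x h1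
    refine node _ hf fun u hu => (hS u hu).1 _ ?_
    rw [hf u (Set.Ioc_subset_Icc_self hu)]
    linarith [hle u (trainPt n D 1) (by linarith)]
  rcases le_or_gt (trainPt n D n - κ * √t) x with h2 | h2
  · have hf := fun v hv => (hψ v hv).2.1 x h2
    refine node _ hf fun u hu => (hS u hu).2.1 _ ?_
    rw [hf u (Set.Ioc_subset_Icc_self hu)]
    linarith [hge u (trainPt n D n) (by linarith)]
  obtain ⟨k, hk, hkn, hx | ⟨hk2, hx⟩⟩ :=
    exists_gap_or_node (trainPt n D) (by positivity) h1 n (by omega) h2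
  · have hf := fun v hv => (hψ v hv).2.2.2 k hk (by omega) x hx
    have hA : 0 < Δ - κ * √t := by linarith
    refine ⟨by rw [hf t ⟨ht.le, le_rfl⟩, div_self hA.ne']; ring, fun u hu => ?_⟩
    have hu' := Set.Ioc_subset_Icc_self hu
    have hut : κ * √u ≤ κ * √t := by gcongr; exact hu.2
    have hnext : trainPt n D (k + 1) = trainPt n D k + 2 * Δ := by
      simp only [trainPt, Δ]
      push_cast
      ring
    rw [hnext] at hx
    have hr : 0 ≤ (Δ - κ * √u) / (Δ - κ * √t) := div_nonneg (by linarith) hA.le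
    have hrA : (Δ - κ * √u) / (Δ - κ * √t) * (Δ - κ * √t) = Δ - κ * √u :=
      div_mul_cancel₀ _ hA.ne'
    have hmem : ψ u x ∈ Set.Icc (trainPt n D k + κ * √u) (trainPt n D (k + 1) - κ * √u) := by
      rw [hf u hu', hnext]
      have h3 := mul_le_mul_of_nonneg_left
        (show x - (trainPt n D k + Δ) ≤ Δ - κ * √t by linarith [hx.2]) hr
      have h4 := mul_le_mul_of_nonneg_left
        (show -(Δ - κ * √t) ≤ x - (trainPt n D k + Δ) by linarith [hx.1]) hr
      rw [mul_neg] at h4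
      constructor <;> linarith
    rw [(hS u hu).2.2.2 k hk (by omega) _ hmem, hf u hu']
    exact (hasDerivAt_affine_flow hu.1 (by linarith) _ x).hasDerivWithinAt.congr_of_mem
      (fun v hv => hf v (Set.Ioc_subset_Icc_self hv)) hu
  · have hf := fun v hv => (hψ v hv).2.2.1 k hk2 (by omega) x hx
    refine node _ hf fun u hu => (hS u hu).2.2.1 k hk2 (by omega) _ ?_
    rw [hf u (Set.Ioc_subset_Icc_self hu)]
    constructor
    · linarith [hge u (trainPt n D k) (by linarith [hx.1])]
    · linarith [hle u (trainPt n D k) (by linarith [hx.2])]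
end

section
/- Let κ > 0 and 0 < t < 1/κ², and let μ be a probability measure on ℝ with Lebesgue density p. Then the pushforward measure of μ under φ_{0|t} equals a₊ · δ_{+1} + a₋ · δ_{−1} + ν, where a₊ = μ({x : x ≥ 1 − δ_t}), a₋ = μ({x : x ≤ δ_t − 1}), δ_{±1} are the Dirac measures at ±1, and ν is the measure with Lebesgue density x ↦ (1 − δ_t) · p((1 − δ_t) x) on the interval (−1, 1) and density zero outside (−1, 1). -/
open MeasureTheory Real Set Filter
open scoped ENNReal

/-- The terminal flow map `φ_{0|t}` (with `δ_t = κ√t`) for the training set `{-1, +1}`. -/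
noncomputable def phiZero (κ t x : ℝ) : ℝ :=
  if |x| ≤ 1 - κ * Real.sqrt t then x / (1 - κ * Real.sqrt t) else Real.sign x

theorem phiZero_of_le {κ t x : ℝ} (hc : 0 < 1 - κ * Real.sqrt t)
    (hx : 1 - κ * Real.sqrt t ≤ x) : phiZero κ t x = 1 := by
  unfold phiZero
  rw [abs_of_pos (hc.trans_le hx)]
  split_ifs with h
  · rw [le_antisymm h hx, div_self hc.ne']
  · exact Real.sign_of_pos (hc.trans_le hx)

theorem phiZero_of_le_neg {κ t x : ℝ} (hc : 0 < 1 - κ * Real.sqrt t)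
    (hx : x ≤ κ * Real.sqrt t - 1) : phiZero κ t x = -1 := by
  have hx0 : x < 0 := by linarith
  unfold phiZero
  rw [abs_of_neg hx0]
  split_ifs with h
  · rw [div_eq_iff hc.ne']
    linarith
  · exact Real.sign_of_neg hx0

theorem phiZero_mul_of_abs_le_one {κ t y : ℝ} (hc : 0 < 1 - κ * Real.sqrt t)
    (hy : |y| ≤ 1) : phiZero κ t ((1 - κ * Real.sqrt t) * y) = y := by
  unfold phiZero
  rw [if_pos, mul_div_cancel_left₀ _ hc.ne']
  rw [abs_mul, abs_of_pos hc]
  exact mul_le_of_le_one_right hc.le hy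

theorem measurable_phiZero (κ t : ℝ) : Measurable (phiZero κ t) := by
  have hsign : Measurable Real.sign :=
    Measurable.ite measurableSet_Iio measurable_const
      (Measurable.ite measurableSet_Ioi measurable_const measurable_const)
  exact Measurable.ite (measurableSet_le (by fun_prop) measurable_const) (by fun_prop) hsign

/-- the pushforward of a probability density `p` under the terminal flow
map `φ_{0|t}` is a mixture of Dirac masses at `±1` with weights `μ({x : x ≥ 1-δ_t})`,
`μ({x : x ≤ δ_t-1})` and an absolutely continuous part with density
`x ↦ (1-δ_t) p((1-δ_t)x)` on `(-1,1)`. -/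
theorem stmt_11 (κ : ℝ) (hκ : 0 < κ) (t : ℝ) (ht : 0 < t) (ht' : t < 1 / κ ^ 2)
    (μ : Measure ℝ) [IsProbabilityMeasure μ]
    (p : ℝ → ℝ) (hp : Measurable p) (hp0 : ∀ x, 0 ≤ p x)
    (hμ : μ = MeasureTheory.volume.withDensity fun x => ENNReal.ofReal (p x)) :
    Measure.map (phiZero κ t) μ =
      μ {x | 1 - κ * Real.sqrt t ≤ x} • Measure.dirac (1 : ℝ) +
      μ {x | x ≤ κ * Real.sqrt t - 1} • Measure.dirac (-1 : ℝ) +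
      MeasureTheory.volume.withDensity fun x =>
        if x ∈ Set.Ioo (-1 : ℝ) 1 then
          ENNReal.ofReal ((1 - κ * Real.sqrt t) * p ((1 - κ * Real.sqrt t) * x))
        else 0 := by
  set c := 1 - κ * Real.sqrt t with hc_def
  have hc : 0 < c := by
    have h : κ ^ 2 * t < 1 := by rwa [lt_div_iff₀ (by positivity), mul_comm] at ht'
    have hs : (κ * Real.sqrt t) ^ 2 < 1 := by rwa [mul_pow, Real.sq_sqrt ht.le]
    have := (abs_lt.mp ((sq_lt_one_iff_abs_lt_one _).mp hs)).2
    linarith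
  have hneg : κ * Real.sqrt t - 1 = -c := by rw [hc_def]; ring
  have hright : ∀ x, c ≤ x → phiZero κ t x = 1 := fun x hx => phiZero_of_le hc hx
  have hleft : ∀ x, x ≤ -c → phiZero κ t x = -1 :=
    fun x hx => phiZero_of_le_neg hc (hx.trans_eq hneg.symm)
  have hmid : ∀ y, |y| ≤ 1 → phiZero κ t (c * y) = y :=
    fun y hy => phiZero_mul_of_abs_le_one hc hy
  rw [hneg]
  ext s hs
  have hpre : MeasurableSet (phiZero κ t ⁻¹' s) := measurable_phiZero κ t hs
  rw [Measure.map_apply (measurable_phiZero κ t) hs, Measure.add_apply, Measure.add_apply,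
    Measure.smul_apply, Measure.smul_apply, Measure.dirac_apply' _ hs,
    Measure.dirac_apply' _ hs, smul_eq_mul, smul_eq_mul]
  have hA : μ (phiZero κ t ⁻¹' s ∩ Ici c) = μ {x | c ≤ x} * s.indicator 1 1 := by
    by_cases h1 : (1 : ℝ) ∈ s
    · rw [indicator_of_mem h1, Pi.one_apply, mul_one]
      congr 1
      ext x
      simp only [mem_inter_iff, mem_preimage, mem_Ici, mem_ofPred_eq, and_iff_right_iff_imp]
      intro hx
      rwa [hright x hx]
    · rw [indicator_of_notMem h1, mul_zero]
      convert measure_empty (μ := μ)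
      ext x
      simp only [mem_inter_iff, mem_preimage, mem_Ici, mem_empty_iff_false, iff_false, not_and]
      intro hxs hx
      exact h1 (hright x hx ▸ hxs)
  have hB : μ (phiZero κ t ⁻¹' s ∩ Iic (-c)) = μ {x | x ≤ -c} * s.indicator 1 (-1) := by
    by_cases h1 : (-1 : ℝ) ∈ s
    · rw [indicator_of_mem h1, Pi.one_apply, mul_one]
      congr 1
      ext x
      simp only [mem_inter_iff, mem_preimage, mem_Iic, mem_ofPred_eq, and_iff_right_iff_imp]
      intro hx
      rwa [hleft x hx]
    · rw [indicator_of_notMem h1, mul_zero]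
      convert measure_empty (μ := μ)
      ext x
      simp only [mem_inter_iff, mem_preimage, mem_Iic, mem_empty_iff_false, iff_false, not_and]
      intro hxs hx
      exact h1 (hleft x hx ▸ hxs)
  have himage : phiZero κ t ⁻¹' s ∩ Ioo (-c) c = (fun y => c * y) '' (s ∩ Ioo (-1) 1) := by
    ext x
    constructor
    · rintro ⟨hxs, hx1, hx2⟩
      have hy1 : -1 < x / c := by rw [lt_div_iff₀ hc]; linarith
      have hy2 : x / c < 1 := by rwa [div_lt_one hc]
      have hx : c * (x / c) = x := mul_div_cancel₀ x hc.ne'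
      refine ⟨x / c, ⟨?_, hy1, hy2⟩, hx⟩
      rw [← hmid (x / c) (abs_le.mpr ⟨hy1.le, hy2.le⟩), hx]
      exact hxs
    · rintro ⟨y, ⟨hys, hy1, hy2⟩, rfl⟩
      refine ⟨?_, by nlinarith, by nlinarith⟩
      rw [mem_preimage, hmid y (abs_le.mpr ⟨hy1.le, hy2.le⟩)]
      exact hys
  have hC : μ (phiZero κ t ⁻¹' s ∩ Ioo (-c) c) =
      (volume.withDensity fun x => if x ∈ Ioo (-1 : ℝ) 1 then
        ENNReal.ofReal (c * p (c * x)) else 0) s := by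
    have hderiv : ∀ x ∈ s ∩ Ioo (-1) 1,
        HasDerivWithinAt (fun y => c * y) c (s ∩ Ioo (-1) 1) x := fun x _ => by
      simpa using ((hasDerivAt_id x).const_mul c).hasDerivWithinAt
    rw [hμ, withDensity_apply _ (hpre.inter measurableSet_Ioo), withDensity_apply _ hs, himage,
      lintegral_image_eq_lintegral_abs_deriv_mul (hs.inter measurableSet_Ioo) hderiv
        (mul_right_injective₀ hc.ne').injOn, inter_comm, ← Measure.restrict_restrict
        measurableSet_Ioo, ← lintegral_indicator measurableSet_Ioo]
    congr 1
    ext x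
    rw [indicator_apply, abs_of_pos hc, ENNReal.ofReal_mul hc.le]
  have hcompl : (Ici c)ᶜ = Iic (-c) ∪ Ioo (-c) c := by
    rw [compl_Ici, Iic_union_Ioo_eq_Iio (by linarith)]
  have hdisj : Disjoint (Iic (-c)) (Ioo (-c) c) :=
    Set.disjoint_left.mpr fun x hx hx' => not_lt_of_ge hx hx'.1
  rw [← hA, ← hB, ← hC, ← measure_inter_add_sdiff _ (measurableSet_Ici (a := c)),
    sdiff_eq, hcompl, inter_union_distrib_left,
    measure_union (hdisj.mono inter_subset_right inter_subset_right)
      (hpre.inter measurableSet_Ioo), add_assoc]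
end

section
/- Fix d ≥ 1 and t > 0. Let g: ℝ → ℝ be continuous and differentiable except at finitely many points, and define f⃗_g: ℝ^d → ℝ^d by f⃗_g(x) = (g(x₁), −x₂/t, …, −x_d/t). Then L^{(d)}_t[f⃗_g] = L_t[g] and R^{(d)}[f⃗_g] = R[g]. -/
open MeasureTheory Real Set Filter
open scoped ENNReal

/-- The `(d+1)`-dimensional noised empirical density
`p^{(d)}_t(x) = p_t(x₁) ∏_{i≥2} p_N(x_i; √t)`. -/
noncomputable def pEmpD (n : ℕ) (D : ℝ) (d : ℕ) (t : ℝ)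
    (x : EuclideanSpace ℝ (Fin (d + 1))) : ℝ :=
  pEmp n D t (x 0) *
    ∏ i ∈ Finset.univ.erase (0 : Fin (d + 1)), gaussD (x i) (Real.sqrt t)

/-- The `(d+1)`-dimensional score matching loss
`L^{(d)}_t[f] = t ∫ ‖f(x) - ∇ log p^{(d)}_t(x)‖² p^{(d)}_t(x) dx`. -/
noncomputable def scoreLossD (n : ℕ) (D : ℝ) (d : ℕ) (t : ℝ)
    (f : EuclideanSpace ℝ (Fin (d + 1)) → EuclideanSpace ℝ (Fin (d + 1))) : ℝ :=
  t * ∫ x, ‖f x - gradient (fun y => Real.log (pEmpD n D d t y)) x‖ ^ 2 * pEmpD n D d t x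

/-- The `(d+1)`-dimensional non-smoothness measure `R^{(d)}[f]`: the supremum over unit
vectors `w` and offsets `b` of the total variation over ℝ of the derivative of the line
restriction `x ↦ f(wx + b)`. -/
noncomputable def RnsD (d : ℕ)
    (f : EuclideanSpace ℝ (Fin (d + 1)) → EuclideanSpace ℝ (Fin (d + 1))) : ℝ≥0∞ :=
  ⨆ (w : EuclideanSpace ℝ (Fin (d + 1))) (_ : ‖w‖ = 1)
    (b : EuclideanSpace ℝ (Fin (d + 1))),
    eVariationOn (deriv fun x : ℝ => f (x • w + b))
      {x | DifferentiableAt ℝ (fun x : ℝ => f (x • w + b)) x}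

lemma gaussD_eq_gaussianPDFReal {t : ℝ} (ht : 0 < t) (x : ℝ) :
    gaussD x (Real.sqrt t) = ProbabilityTheory.gaussianPDFReal 0 t.toNNReal x := by
  rw [gaussD, ProbabilityTheory.gaussianPDFReal, Real.sq_sqrt ht.le, sub_zero,
    Real.coe_toNNReal t ht.le, Real.sqrt_mul (x := 2 * Real.pi) (by positivity) t]

lemma integral_gaussD_s12 {t : ℝ} (ht : 0 < t) : ∫ x, gaussD x (Real.sqrt t) = 1 := by
  simp_rw [gaussD_eq_gaussianPDFReal ht]
  exact ProbabilityTheory.integral_gaussianPDFReal_eq_one 0 (Real.toNNReal_pos.2 ht).ne'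

lemma gaussD_pos_s12 {σ : ℝ} (hσ : 0 < σ) (x : ℝ) : 0 < gaussD x σ := by
  unfold gaussD
  positivity

lemma pEmp_pos {n : ℕ} (hn : 1 ≤ n) (D : ℝ) {t : ℝ} (ht : 0 < t) (x : ℝ) :
    0 < pEmp n D t x := by
  unfold pEmp
  have : (0 : ℝ) < n := by exact_mod_cast hn
  refine mul_pos (by positivity) (Finset.sum_pos (fun k _ => gaussD_pos_s12 (Real.sqrt_pos.2 ht) _) ?_)
  exact Finset.nonempty_Icc.2 hn

lemma differentiable_pEmp (n : ℕ) (D t : ℝ) : Differentiable ℝ (pEmp n D t) := by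
  unfold pEmp gaussD
  fun_prop

lemma hasDerivAt_log_pEmp {n : ℕ} (hn : 1 ≤ n) (D : ℝ) {t : ℝ} (ht : 0 < t) (x : ℝ) :
    HasDerivAt (fun y => Real.log (pEmp n D t y)) (scoreEmp n D t x) x :=
  ((differentiable_pEmp n D t x).log (pEmp_pos hn D ht x).ne').hasDerivAt

lemma hasDerivAt_log_gaussD {t : ℝ} (ht : 0 < t) (x : ℝ) :
    HasDerivAt (fun y => Real.log (gaussD y (Real.sqrt t))) (-x / t) x := by
  have h : (fun y => Real.log (gaussD y (Real.sqrt t))) =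
      fun y => Real.log ((Real.sqrt (2 * Real.pi) * Real.sqrt t)⁻¹) + -y ^ 2 / (2 * t) := by
    funext y
    rw [gaussD, Real.log_mul (by positivity) (Real.exp_pos _).ne', Real.log_exp,
      Real.sq_sqrt ht.le]
  rw [h]
  have := (((hasDerivAt_pow 2 x).neg).div_const (2 * t)).const_add
    (Real.log ((Real.sqrt (2 * Real.pi) * Real.sqrt t)⁻¹))
  refine this.congr_deriv ?_
  rw [← mul_div_mul_left (-x) t two_ne_zero]
  norm_num

/-- The gradient of a sum of functions of the separate coordinates. -/
lemma hasGradientAt_sum_coord {ι : Type*} [Fintype ι] {φ : ι → ℝ → ℝ}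
    {v x : EuclideanSpace ℝ ι} (h : ∀ i, HasDerivAt (φ i) (v i) (x i)) :
    HasGradientAt (fun y : EuclideanSpace ℝ ι => ∑ i, φ i (y i)) v x := by
  rw [hasGradientAt_iff_hasFDerivAt]
  have := HasFDerivAt.fun_sum (u := Finset.univ) fun i _ =>
    (h i).comp_hasFDerivAt x (EuclideanSpace.proj (𝕜 := ℝ) i).hasFDerivAt
  refine this.congr_fderiv ?_
  ext y
  simp [PiLp.inner_apply, mul_comm]

lemma gradient_log_pEmpD {n : ℕ} (hn : 1 ≤ n) (D : ℝ) (d : ℕ) {t : ℝ} (ht : 0 < t)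
    (x : EuclideanSpace ℝ (Fin (d + 1))) :
    gradient (fun y => Real.log (pEmpD n D d t y)) x =
      WithLp.toLp 2 fun i => if i = 0 then scoreEmp n D t (x 0) else -(x i) / t := by
  have h : (fun y => Real.log (pEmpD n D d t y)) =
      fun y => ∑ i, (if i = 0 then fun s => Real.log (pEmp n D t s)
        else fun s => Real.log (gaussD s (Real.sqrt t))) (y i) := by
    funext y
    rw [pEmpD, Real.log_mul (pEmp_pos hn D ht _).ne'
      (Finset.prod_pos fun i _ => gaussD_pos_s12 (Real.sqrt_pos.2 ht) _).ne',
      Real.log_prod fun i _ => (gaussD_pos_s12 (Real.sqrt_pos.2 ht) _).ne',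
      ← Finset.add_sum_erase _ _ (Finset.mem_univ (0 : Fin (d + 1)))]
    congr 1
    exact Finset.sum_congr rfl fun i hi => by rw [if_neg (Finset.ne_of_mem_erase hi)]
  rw [h]
  refine (hasGradientAt_sum_coord fun i => ?_).gradient
  by_cases hi : i = 0
  · subst hi
    simpa using hasDerivAt_log_pEmp hn D ht (x 0)
  · simpa [hi] using hasDerivAt_log_gaussD ht (x i)

/-- The integral over Euclidean space of a product of functions of the separate coordinates. -/
lemma integral_prod_coord {ι : Type*} [Fintype ι] (φ : ι → ℝ → ℝ) :
    ∫ x : EuclideanSpace ℝ ι, ∏ i, φ i (x i) = ∏ i, ∫ s, φ i s := by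
  rw [← integral_fintype_prod_volume_eq_prod]
  exact (EuclideanSpace.volume_preserving_symm_measurableEquiv_toLp ι).integral_comp'
    (fun x : ι → ℝ => ∏ i, φ i (x i))

lemma scoreLossD_flat_extension {n : ℕ} (hn : 1 ≤ n) (D : ℝ) (d : ℕ) {t : ℝ} (ht : 0 < t)
    (g : ℝ → ℝ) (fg : EuclideanSpace ℝ (Fin (d + 1)) → EuclideanSpace ℝ (Fin (d + 1)))
    (hfg : ∀ x i, fg x i = if i = 0 then g (x 0) else -(x i) / t) :
    scoreLossD n D d t fg = scoreLoss n D t g := by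
  have hint : ∀ x, ‖fg x - gradient (fun y => Real.log (pEmpD n D d t y)) x‖ ^ 2 *
      pEmpD n D d t x = ∏ i, (if i = 0 then fun s => |g s - scoreEmp n D t s| ^ 2 * pEmp n D t s
        else fun s => gaussD s (Real.sqrt t)) (x i) := by
    intro x
    have hnorm : ‖fg x - gradient (fun y => Real.log (pEmpD n D d t y)) x‖ ^ 2 =
        |g (x 0) - scoreEmp n D t (x 0)| ^ 2 := by
      rw [gradient_log_pEmpD hn D d ht, EuclideanSpace.norm_sq_eq,
        Finset.sum_eq_single_of_mem 0 (Finset.mem_univ _)]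
      · simp [hfg]
      · intro i _ hi
        simp [hfg, hi]
    rw [hnorm, pEmpD, ← mul_assoc, ← Finset.mul_prod_erase _ _ (Finset.mem_univ (0 : Fin (d + 1)))]
    congr 1
    exact Finset.prod_congr rfl fun i hi => by rw [if_neg (Finset.ne_of_mem_erase hi)]
  rw [scoreLossD, scoreLoss]
  simp_rw [hint]
  rw [integral_prod_coord, ← Finset.mul_prod_erase _ _ (Finset.mem_univ (0 : Fin (d + 1))),
    Finset.prod_eq_one]
  · simp
  · intro i hi
    rw [if_neg (Finset.ne_of_mem_erase hi)]
    exact integral_gaussD_s12 ht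

lemma differentiableAt_comp_affine_iff (g : ℝ → ℝ) {a : ℝ} (ha : a ≠ 0) (b x : ℝ) :
    DifferentiableAt ℝ (fun s => g (s * a + b)) x ↔ DifferentiableAt ℝ g (x * a + b) := by
  refine ⟨fun h => ?_, fun h => ?_⟩
  · have hx : DifferentiableAt ℝ (fun s => g (s * a + b)) ((x * a + b - b) / a) := by
      rwa [add_sub_cancel_right, mul_div_cancel_right₀ _ ha]
    have := DifferentiableAt.fun_comp' (f := fun s => (s - b) / a) (x * a + b) hx (by fun_prop)
    simpa [div_mul_cancel₀ _ ha] using this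
  · exact DifferentiableAt.fun_comp' (f := fun s => s * a + b) x h (by fun_prop)

lemma deriv_euclidean_apply {ι : Type*} [Fintype ι] {f : ℝ → EuclideanSpace ℝ ι} {x : ℝ}
    (h : DifferentiableAt ℝ f x) (i : ι) : deriv f x i = deriv (fun s => f s i) x :=
  ((EuclideanSpace.proj (𝕜 := ℝ) i).hasFDerivAt.comp_hasDerivAt x h.hasDerivAt).deriv.symm

section FlatExtension

variable {d : ℕ} {t : ℝ} {g : ℝ → ℝ}
  {fg : EuclideanSpace ℝ (Fin (d + 1)) → EuclideanSpace ℝ (Fin (d + 1))}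

lemma flat_extension_line_zero
    (hfg : ∀ x i, fg x i = if i = 0 then g (x 0) else -(x i) / t)
    (w b : EuclideanSpace ℝ (Fin (d + 1))) :
    (fun s : ℝ => fg (s • w + b) 0) = fun s => g (s * w 0 + b 0) := by
  funext s
  simp [hfg]

lemma hasDerivAt_flat_extension_line_ne_zero
    (hfg : ∀ x i, fg x i = if i = 0 then g (x 0) else -(x i) / t)
    (w b : EuclideanSpace ℝ (Fin (d + 1))) {i : Fin (d + 1)} (hi : i ≠ 0) (x : ℝ) :
    HasDerivAt (fun s : ℝ => fg (s • w + b) i) (-(w i) / t) x := by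
  have h : (fun s : ℝ => fg (s • w + b) i) = fun s => -(s * w i + b i) / t := by
    funext s
    simp [hfg, hi]
  rw [h]
  simpa using ((((hasDerivAt_id x).mul_const (w i)).add_const (b i)).neg).div_const t

lemma eVariationOn_flat_extension_line_le
    (hfg : ∀ x i, fg x i = if i = 0 then g (x 0) else -(x i) / t)
    {w : EuclideanSpace ℝ (Fin (d + 1))} (hw : ‖w‖ = 1) (b : EuclideanSpace ℝ (Fin (d + 1))) :
    eVariationOn (deriv fun x : ℝ => fg (x • w + b))
      {x | DifferentiableAt ℝ (fun x : ℝ => fg (x • w + b)) x} ≤ Rns g := by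
  set S := {x | DifferentiableAt ℝ (fun x : ℝ => fg (x • w + b)) x} with hS
  set Φ : ℝ → EuclideanSpace ℝ (Fin (d + 1)) := fun r =>
    WithLp.toLp 2 fun i => if i = 0 then r * w 0 else -(w i) / t with hΦ
  have hw0 : |w 0| ≤ 1 := by simpa [hw] using PiLp.norm_apply_le w 0
  have hcoord : ∀ x ∈ S, DifferentiableAt ℝ (fun s => g (s * w 0 + b 0)) x := fun x hx => by
    rw [← flat_extension_line_zero hfg w b]
    exact differentiableAt_euclidean.1 hx 0
  have hderiv : EqOn (deriv fun x : ℝ => fg (x • w + b))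
      (Φ ∘ deriv g ∘ fun s => s * w 0 + b 0) S := by
    intro x hx
    ext i
    rw [deriv_euclidean_apply hx]
    by_cases hi : i = 0
    · subst hi
      rw [flat_extension_line_zero hfg w b]
      by_cases ha : w 0 = 0
      · simp [hΦ, ha]
      · have hg := (differentiableAt_comp_affine_iff g ha (b 0) x).1 (hcoord x hx)
        have hline : HasDerivAt (fun s : ℝ => s * w 0 + b 0) (w 0) x := by
          simpa using ((hasDerivAt_id x).mul_const (w 0)).add_const (b 0)
        simpa [hΦ, Function.comp_def] using (hg.hasDerivAt.comp x hline).deriv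
    · simpa [hΦ, hi] using (hasDerivAt_flat_extension_line_ne_zero hfg w b hi x).deriv
  rw [eVariationOn.eq_of_eqOn hderiv]
  have hLip : LipschitzWith 1 Φ := by
    refine LipschitzWith.mk_one fun r s => ?_
    have hsub : Φ r - Φ s = EuclideanSpace.single 0 ((r - s) * w 0) := by
      ext i
      by_cases hi : i = 0 <;> simp [hΦ, hi, sub_mul]
    rw [dist_eq_norm, hsub, PiLp.norm_single, Real.norm_eq_abs, abs_mul, Real.dist_eq]
    exact mul_le_of_le_one_right (abs_nonneg _) hw0
  by_cases ha : w 0 = 0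
  · rw [eVariationOn.constant_on]
    · exact zero_le
    · rintro _ ⟨x, _, rfl⟩ _ ⟨y, _, rfl⟩
      simp [ha]
  have hmaps : MapsTo (fun s => s * w 0 + b 0) S {x | DifferentiableAt ℝ g x} := fun x hx =>
    (differentiableAt_comp_affine_iff g ha (b 0) x).1 (hcoord x hx)
  calc eVariationOn (Φ ∘ deriv g ∘ fun s => s * w 0 + b 0) S
      ≤ (1 : NNReal) * eVariationOn (deriv g ∘ fun s => s * w 0 + b 0) S :=
        (hLip.lipschitzOnWith (s := univ)).comp_eVariationOn_le (mapsTo_univ _ _)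
    _ = eVariationOn (deriv g ∘ fun s => s * w 0 + b 0) S := by simp
    _ ≤ Rns g := by
      rcases le_total 0 (w 0) with h | h
      · refine eVariationOn.comp_le_of_monotoneOn _ _ (fun x _ y _ hxy => ?_) hmaps
        simpa using mul_le_mul_of_nonneg_right hxy h
      · refine eVariationOn.comp_le_of_antitoneOn _ _ (fun x _ y _ hxy => ?_) hmaps
        simpa using mul_le_mul_of_nonpos_right hxy h

lemma Rns_le_eVariationOn_flat_extension_axis
    (hfg : ∀ x i, fg x i = if i = 0 then g (x 0) else -(x i) / t) :
    Rns g ≤ eVariationOn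
      (deriv fun x : ℝ => fg (x • EuclideanSpace.single (0 : Fin (d + 1)) (1 : ℝ) + 0))
      {x | DifferentiableAt ℝ
        (fun x : ℝ => fg (x • EuclideanSpace.single (0 : Fin (d + 1)) (1 : ℝ) + 0)) x} := by
  set w := EuclideanSpace.single (0 : Fin (d + 1)) (1 : ℝ) with hw
  have hzero : (fun s : ℝ => fg (s • w + 0) 0) = g := by
    rw [flat_extension_line_zero hfg w 0]
    simp [hw]
  have hset : {x | DifferentiableAt ℝ (fun x : ℝ => fg (x • w + 0)) x} =
      {x | DifferentiableAt ℝ g x} := by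
    ext x
    rw [mem_ofPred_eq, mem_ofPred_eq, differentiableAt_euclidean]
    refine ⟨fun h => hzero ▸ h 0, fun h i => ?_⟩
    by_cases hi : i = 0
    · rw [hi, hzero]
      exact h
    · exact (hasDerivAt_flat_extension_line_ne_zero hfg w 0 hi x).differentiableAt
  have hderiv : EqOn (deriv g)
      ((fun v : EuclideanSpace ℝ (Fin (d + 1)) => v 0) ∘ deriv fun x : ℝ => fg (x • w + 0))
      {x | DifferentiableAt ℝ g x} := by
    intro x hx
    rw [← hset] at hx
    rw [Function.comp_apply, deriv_euclidean_apply hx, hzero]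
  have hLip : LipschitzWith 1 fun v : EuclideanSpace ℝ (Fin (d + 1)) => v 0 :=
    LipschitzWith.mk_one fun u v => by
      simpa [dist_eq_norm] using PiLp.norm_apply_le (u - v) 0
  rw [Rns, eVariationOn.eq_of_eqOn hderiv, hset]
  simpa using (hLip.lipschitzOnWith (s := univ)).comp_eVariationOn_le
    (g := deriv fun x : ℝ => fg (x • w + 0)) (mapsTo_univ _ {x | DifferentiableAt ℝ g x})

lemma RnsD_flat_extension
    (hfg : ∀ x i, fg x i = if i = 0 then g (x 0) else -(x i) / t) :
    RnsD d fg = Rns g :=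
  le_antisymm
    (iSup_le fun _ => iSup_le fun hw => iSup_le fun b =>
      eVariationOn_flat_extension_line_le hfg hw b)
    ((Rns_le_eVariationOn_flat_extension_axis hfg).trans <|
      le_iSup_of_le (EuclideanSpace.single 0 1) <| le_iSup_of_le (by simp) <|
        le_iSup_of_le 0 le_rfl)

end FlatExtension

/-- for the flat extension `f⃗_g(x) = (g(x₁), -x₂/t, …, -x_d/t)` of a
one-dimensional function `g`, one has `L^{(d)}_t[f⃗_g] = L_t[g]` and `R^{(d)}[f⃗_g] = R[g]`
(dimension is `d + 1 ≥ 1`). -/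
theorem stmt_12 (n : ℕ) (hn : 2 ≤ n) (D : ℝ) (hD : 0 < D) (d : ℕ) (t : ℝ) (ht : 0 < t)
    (g : ℝ → ℝ) (hg : Continuous g) (hgd : {x | ¬ DifferentiableAt ℝ g x}.Finite)
    (fg : EuclideanSpace ℝ (Fin (d + 1)) → EuclideanSpace ℝ (Fin (d + 1)))
    (hfg : ∀ x i, fg x i = if i = 0 then g (x 0) else -(x i) / t) :
    scoreLossD n D d t fg = scoreLoss n D t g ∧ RnsD d fg = Rns g := by
  exact ⟨scoreLossD_flat_extension (by omega) D d ht g fg hfg, RnsD_flat_extension hfg⟩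
end
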